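/- The proportion of odd entries in the character table of the symmetric group S_n tends to 0 as n → ∞; i.e., #{(λ,μ) : λ, μ ⊢ n, χ^λ_μ odd}/p(n)² → 0. -/

import Mathlib

open Filter
open scoped BigOperators

/-- Irreducible character of `S_n` via the Frobenius character formula. -/
noncomputable def charSn (n : ℕ) (lam mu : Nat.Partition n) : ℤ :=
  MvPolynomial.coeff
    (Finsupp.equivFunOnFinite.symm fun i : Fin n =>
      ((lam.parts.sort (· ≤ ·)).reverse.getD i 0) + (n - 1 - (i : ℕ)))
    ((∏ i : Fin n, ∏ j ∈ Finset.univ.filter (fun j : Fin n => (i : ℕ) < (j : ℕ)),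
        (MvPolynomial.X i - MvPolynomial.X j)) *
      (mu.parts.map (fun m => ∑ i : Fin n, MvPolynomial.X i ^ m)).prod)


/-- Summatory function of the divisor sum. -/
def pS (k : ℕ) : ℕ := ∑ j ∈ Finset.Icc 1 k, ∑ d ∈ Finset.Icc 1 (k / j), d

lemma pS_inner (m : ℕ) : ((∑ d ∈ Finset.Icc 1 m, d : ℕ) : ℝ) = (m : ℝ) * (m + 1) / 2 := by
  induction m with
  | zero => simp
  | succ k ih =>
    rw [Finset.sum_Icc_succ_top (by omega)]
    push_cast at ih ⊢
    rw [ih]; ring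

lemma pS_tendsto : ∃ z : ℝ, 0 < z ∧
    Tendsto (fun k : ℕ => (pS k : ℝ) / (((k : ℝ) + 1) * (k + 2) / 2)) atTop (nhds z) := by
  have hsum : Summable (fun j : ℕ => 1 / ((j : ℝ) + 1) ^ 2) := by
    have := (summable_nat_add_iff 1).2 (Real.summable_one_div_nat_pow.2 (by norm_num : 1 < 2))
    simpa using this
  have hfl : ∀ j : ℕ, Tendsto (fun k : ℕ => ((k / (j + 1) : ℕ) : ℝ) / k) atTop
      (nhds (1 / ((j : ℝ) + 1))) := by
    intro j
    have h := tendsto_nat_floor_mul_div_atTop (R := ℝ) (a := 1 / ((j : ℝ) + 1)) (by positivity)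
    have h2 := h.comp (tendsto_natCast_atTop_atTop (R := ℝ))
    refine h2.congr' ?_
    filter_upwards with k
    simp only [Function.comp]
    congr 2
    rw [one_div_mul_eq_div]
    have := Nat.floor_div_natCast (K := ℝ) (k : ℝ) (j + 1)
    push_cast at this
    rw [this]; simp
  have hT := tendsto_tsum_of_dominated_convergence (𝓕 := atTop)
    (f := fun (k : ℕ) (j : ℕ) =>
      (((k / (j + 1) : ℕ) : ℝ) * ((k / (j + 1) : ℕ) + 1) / 2) / (k : ℝ) ^ 2)
    (g := fun j : ℕ => (1 / ((j : ℝ) + 1)) ^ 2 / 2)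
    (bound := fun j : ℕ => 1 / ((j : ℝ) + 1) ^ 2) hsum
    (by
      intro j
      have h1 := hfl j
      have h2 : Tendsto (fun k : ℕ => (1 : ℝ) / k) atTop (nhds 0) :=
        tendsto_one_div_atTop_nhds_zero_nat
      have h3 := (h1.mul (h1.add h2)).div_const 2
      refine (h3.congr' ?_).trans (by
        rw [add_zero, ← sq])
      filter_upwards [eventually_gt_atTop 0] with k hk
      have : (k : ℝ) ≠ 0 := by positivity
      field_simp)
    (by
      filter_upwards [eventually_gt_atTop 0] with k hk j
      rw [Real.norm_of_nonneg (by positivity)]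
      set m := k / (j + 1) with hm
      have hkr : (0 : ℝ) < k := by positivity
      have hmul : (m : ℝ) * (j + 1) ≤ k := by
        have := Nat.div_mul_le_self k (j + 1)
        exact_mod_cast this
      have hm2 : (m : ℝ) * (m + 1) / 2 ≤ (m : ℝ) ^ 2 := by
        rcases Nat.eq_zero_or_pos m with h | h
        · simp [h]
        · have : (1 : ℝ) ≤ m := by exact_mod_cast h
          nlinarith
      rw [div_le_div_iff₀ (by positivity) (by positivity)]
      have : ((m : ℝ) * (j + 1)) ^ 2 ≤ (k : ℝ) ^ 2 := by gcongr
      have h5 : (m : ℝ) * (m + 1) / 2 * (j + 1) ^ 2 ≤ (m : ℝ) ^ 2 * (j + 1) ^ 2 := by gcongr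
      nlinarith)
  set L : ℝ := ∑' j : ℕ, (1 / ((j : ℝ) + 1)) ^ 2 / 2 with hL
  have hLpos : 0 < L := by
    have hs : Summable (fun j : ℕ => (1 / ((j : ℝ) + 1)) ^ 2 / 2) := by
      simpa [div_pow] using hsum.div_const 2
    exact hs.tsum_pos (fun j => by positivity) 0 (by norm_num)
  refine ⟨L * 2, by positivity, ?_⟩
  have hq : Tendsto (fun k : ℕ => (k : ℝ) ^ 2 / (((k : ℝ) + 1) * (k + 2) / 2)) atTop (nhds 2) := by
    have h2 : Tendsto (fun k : ℕ => (1 : ℝ) / k) atTop (nhds 0) :=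
      tendsto_one_div_atTop_nhds_zero_nat
    have h3 : Tendsto (fun k : ℕ => (2 : ℝ) / ((1 + 1 / (k:ℝ)) * (1 + 2 * (1 / (k:ℝ))))) atTop
        (nhds (2 / ((1 + 0) * (1 + 2 * 0)))) := by
      refine Tendsto.div tendsto_const_nhds ((tendsto_const_nhds.add h2).mul
        (tendsto_const_nhds.add (h2.const_mul 2))) (by norm_num)
    have h4 : (2 : ℝ) / ((1 + 0) * (1 + 2 * 0)) = 2 := by norm_num
    rw [h4] at h3
    refine h3.congr' ?_
    filter_upwards [eventually_gt_atTop 0] with k hk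
    have : (k : ℝ) ≠ 0 := by positivity
    field_simp
  refine (hT.mul hq).congr' ?_
  filter_upwards [eventually_gt_atTop 0] with k hk
  have hkr : (k : ℝ) ≠ 0 := by positivity
  have : ∑' j : ℕ, (((k / (j + 1) : ℕ) : ℝ) * ((k / (j + 1) : ℕ) + 1) / 2) / (k : ℝ) ^ 2
      = (pS k : ℝ) / (k : ℝ) ^ 2 := by
    rw [tsum_eq_sum (s := Finset.range k)]
    · rw [← Finset.sum_div]
      congr 1
      unfold pS
      rw [Nat.cast_sum, Finset.range_eq_Ico, Finset.sum_Ico_add' (fun j => (((k / j : ℕ) : ℝ) * ((k / j : ℕ) + 1) / 2)) 0 k 1]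
      refine Finset.sum_congr ?_ fun j _ => (pS_inner _).symm
      ext x; simp
    · intro j hj
      have : k / (j + 1) = 0 := Nat.div_eq_of_lt (by simp at hj; omega)
      simp [this]
  rw [this]
  field_simp

/-- First differences. -/
noncomputable def pU (p : ℕ → ℝ) (i : ℕ) : ℝ := if i = 0 then p 0 else p i - p (i - 1)
/-- Partial sums. -/
noncomputable def pD (p : ℕ → ℝ) (n : ℕ) : ℝ := ∑ i ∈ Finset.range (n + 1), p i
/-- Partial sums of partial sums. -/
noncomputable def pQ (p : ℕ → ℝ) (n : ℕ) : ℝ := ∑ i ∈ Finset.range (n + 1), pD p i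

lemma pU_sum (p : ℕ → ℝ) (n : ℕ) : ∑ i ∈ Finset.range (n + 1), pU p i = p n := by
  induction n with
  | zero => simp [pU]
  | succ k ih => rw [Finset.sum_range_succ, ih]; simp [pU]

lemma pD_succ (p : ℕ → ℝ) (n : ℕ) : pD p (n + 1) = pD p n + p (n + 1) := by
  simp [pD, Finset.sum_range_succ]

lemma pQ_succ (p : ℕ → ℝ) (n : ℕ) : pQ p (n + 1) = pQ p n + pD p (n + 1) := by
  rw [pQ, Finset.sum_range_succ]; rfl

lemma pD_eq (p : ℕ → ℝ) (n : ℕ) :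
    pD p n = ∑ i ∈ Finset.range (n + 1), pU p i * ((n : ℝ) - i + 1) := by
  induction n with
  | zero => simp [pD, pU]
  | succ k ih =>
    rw [pD_succ, ih, ← pU_sum p (k + 1), Finset.sum_range_succ _ (k + 1),
      Finset.sum_range_succ _ (k + 1), ← add_assoc, ← Finset.sum_add_distrib]
    congr 1
    · refine Finset.sum_congr rfl fun i _ => ?_
      push_cast; ring
    · ring

lemma pQ_eq (p : ℕ → ℝ) (n : ℕ) :
    pQ p n = ∑ i ∈ Finset.range (n + 1),
      pU p i * (((n : ℝ) - i + 1) * ((n : ℝ) - i + 2) / 2) := by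
  induction n with
  | zero => simp [pQ, pD, pU]
  | succ k ih =>
    rw [pQ_succ, ih, pD_eq p (k + 1), Finset.sum_range_succ _ (k + 1),
      Finset.sum_range_succ _ (k + 1), ← add_assoc, ← Finset.sum_add_distrib]
    congr 1
    · refine Finset.sum_congr rfl fun i _ => ?_
      push_cast; ring
    · ring

lemma pD_pos (p : ℕ → ℝ) (hp : ∀ n, 0 < p n) (n : ℕ) : 0 < pD p n :=
  Finset.sum_pos (fun i _ => hp i) (by simp)

lemma pQ_pos (p : ℕ → ℝ) (hp : ∀ n, 0 < p n) (n : ℕ) : 0 < pQ p n :=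
  Finset.sum_pos (fun i _ => pD_pos p hp i) (by simp)

lemma kappa_tendsto (p : ℕ → ℝ) (hp : ∀ n, 0 < p n) (hm : Monotone p)
    (hid : ∀ n : ℕ, (n : ℝ) * p n = ∑ i ∈ Finset.range (n + 1), pU p i * (pS (n - i) : ℝ)) :
    ∃ z : ℝ, 0 < z ∧ Tendsto (fun n : ℕ => (n : ℝ) * p n / pQ p n) atTop (nhds z) := by
  obtain ⟨z, hz, hS⟩ := pS_tendsto
  refine ⟨z, hz, ?_⟩
  have hu : ∀ i, 0 ≤ pU p i := by
    intro i
    unfold pU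
    split_ifs with h
    · exact (hp 0).le
    · have := hm (Nat.sub_le i 1); linarith
  have key : ∀ ε > 0, ∃ C : ℝ, 0 ≤ C ∧ ∀ n : ℕ,
      |(n : ℝ) * p n - z * pQ p n| ≤ ε * pQ p n + C * p n := by
    intro ε hε
    rw [Metric.tendsto_atTop] at hS
    obtain ⟨K, hK⟩ := hS ε hε
    set w : ℕ → ℝ := fun k => ((k : ℝ) + 1) * (k + 2) / 2 with hw
    set C : ℝ := ∑ k ∈ Finset.range K, |(pS k : ℝ) - z * w k| with hC
    have hC0 : 0 ≤ C := Finset.sum_nonneg fun _ _ => abs_nonneg _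
    have hb : ∀ k, |(pS k : ℝ) - z * w k| ≤ ε * w k + C := by
      intro k
      have hwk : 0 < w k := by simp only [hw]; positivity
      by_cases hk : K ≤ k
      · have : |(pS k : ℝ) / w k - z| < ε := by
          have := hK k hk
          rwa [Real.dist_eq] at this
        have h2 : (pS k : ℝ) - z * w k = ((pS k : ℝ) / w k - z) * w k := by field_simp
        rw [h2, abs_mul, abs_of_pos hwk]
        have := mul_le_mul_of_nonneg_right this.le hwk.le
        linarith
      · have : |(pS k : ℝ) - z * w k| ≤ C :=
          Finset.single_le_sum (f := fun k => |(pS k : ℝ) - z * w k|)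
            (fun _ _ => abs_nonneg _) (by simpa using hk)
        have : 0 ≤ ε * w k := by positivity
        linarith
    refine ⟨C, hC0, fun n => ?_⟩
    have h1 : ∀ i ∈ Finset.range (n + 1),
        ((n : ℝ) - i + 1) * ((n : ℝ) - i + 2) / 2 = w (n - i) := by
      intro i hi
      have : i ≤ n := by simp at hi; omega
      simp only [hw]; rw [Nat.cast_sub this]
    have hQw : pQ p n = ∑ i ∈ Finset.range (n + 1), pU p i * w (n - i) := by
      rw [pQ_eq p n]
      exact Finset.sum_congr rfl fun i hi => by rw [h1 i hi]
    rw [hid n, hQw]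
    rw [← pU_sum p n, Finset.mul_sum, Finset.mul_sum, Finset.mul_sum, ← Finset.sum_sub_distrib,
      ← Finset.sum_add_distrib]
    refine (Finset.abs_sum_le_sum_abs _ _).trans (Finset.sum_le_sum fun i _ => ?_)
    have : pU p i * (pS (n - i) : ℝ) - z * (pU p i * w (n - i))
        = pU p i * ((pS (n - i) : ℝ) - z * w (n - i)) := by ring
    rw [this, abs_mul, abs_of_nonneg (hu i)]
    have := mul_le_mul_of_nonneg_left (hb (n - i)) (hu i)
    linarith
  rw [Metric.tendsto_atTop]
  intro ε hε
  set ε1 := min (ε / 2) 1 with hε1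
  have hε1p : 0 < ε1 := by positivity
  obtain ⟨C, hC0, hC⟩ := key ε1 hε1p
  obtain ⟨N, hN⟩ := exists_nat_gt (2 * C + 4 * C * (z + 1) / ε + 1)
  refine ⟨N, fun n hn => ?_⟩
  have hnr : 2 * C + 4 * C * (z + 1) / ε + 1 < (n : ℝ) := lt_of_lt_of_le hN (by exact_mod_cast hn)
  have hx : 0 ≤ 4 * C * (z + 1) / ε := by positivity
  have hQ := pQ_pos p hp n
  have h := hC n
  have hpn := hp n
  have hnpos : (0 : ℝ) < n := by linarith
  rw [Real.dist_eq]
  have e1 : (n : ℝ) * p n / pQ p n - z = ((n : ℝ) * p n - z * pQ p n) / pQ p n := by field_simp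
  rw [e1, abs_div, abs_of_pos hQ, div_lt_iff₀ hQ]
  have h2 := (abs_le.1 h).2
  have h1' : ε1 ≤ 1 := min_le_right _ _
  have h1'' : ε1 ≤ ε / 2 := min_le_left _ _
  have h3 : (n : ℝ) * p n ≤ 2 * (z + 1) * pQ p n := by
    have : C * p n ≤ n / 2 * p n := by
      apply mul_le_mul_of_nonneg_right _ hpn.le; linarith
    have : ε1 * pQ p n ≤ 1 * pQ p n := by gcongr
    linarith
  have h4 : C * p n < ε / 2 * pQ p n := by
    have h5 : 4 * C * (z + 1) < ε * n := by
      have : 4 * C * (z + 1) / ε < n := by linarith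
      rw [div_lt_iff₀ hε] at this; linarith
    have h6 : C * (n * p n) ≤ C * (2 * (z + 1) * pQ p n) := by gcongr
    have h7 : 4 * C * (z + 1) * pQ p n < ε * n * pQ p n := by gcongr
    have : n * (C * p n) < n * (ε / 2 * pQ p n) := by linarith
    exact lt_of_mul_lt_mul_left this hnpos.le
  have h8 : ε1 * pQ p n ≤ ε / 2 * pQ p n := by gcongr
  linarith

lemma contraction_tendsto (z lam e : ℕ → ℝ) (hz : ∀ k, 0 ≤ z k)
    (h : ∀ᶠ k in atTop, z (k + 1) ≤ (1 - lam k) * z k + lam k * e k)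
    (hl : ∀ᶠ k in atTop, 0 ≤ lam k ∧ lam k ≤ 1)
    (hs : Tendsto (fun n => ∑ i ∈ Finset.range n, lam i) atTop atTop)
    (he : Tendsto e atTop (nhds 0)) : Tendsto z atTop (nhds 0) := by
  rw [Metric.tendsto_atTop]
  intro δ hδ
  have he' : ∀ᶠ k in atTop, e k ≤ δ / 2 := he.eventually_le_const (by positivity)
  obtain ⟨N, hN⟩ := eventually_atTop.1 (h.and (hl.and he'))
  have hb : ∀ k ≥ N, z k - δ / 2 ≤
      Real.exp (-(∑ i ∈ Finset.range k, lam i) + ∑ i ∈ Finset.range N, lam i) * z N := by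
    intro k hk
    induction k, hk using Nat.le_induction with
    | base => simp; linarith
    | succ k hk ih =>
      obtain ⟨h1, ⟨h2, h3⟩, h4⟩ := hN k hk
      have h5 : z (k + 1) - δ / 2 ≤ (1 - lam k) * (z k - δ / 2) := by
        have := mul_le_mul_of_nonneg_left h4 h2
        linarith
      refine h5.trans ((mul_le_mul_of_nonneg_left ih (by linarith)).trans ?_)
      rw [Finset.sum_range_succ, ← mul_assoc]
      refine mul_le_mul_of_nonneg_right ?_ (hz N)
      have : (-(∑ i ∈ Finset.range k, lam i + lam k) + ∑ i ∈ Finset.range N, lam i)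
        = -lam k + (-(∑ i ∈ Finset.range k, lam i) + ∑ i ∈ Finset.range N, lam i) := by ring
      rw [this, Real.exp_add (-lam k)]
      gcongr
      have := Real.add_one_le_exp (-lam k)
      linarith
  have ht : Tendsto (fun k => Real.exp (-(∑ i ∈ Finset.range k, lam i) +
      ∑ i ∈ Finset.range N, lam i) * z N) atTop (nhds (0 * z N)) := by
    refine Tendsto.mul_const _ (Real.tendsto_exp_atBot.comp ?_)
    exact tendsto_atBot_add_const_right _ _ (tendsto_neg_atTop_atBot.comp hs)
  rw [zero_mul] at ht
  obtain ⟨M, hM⟩ := eventually_atTop.1 (ht.eventually_lt_const (show 0 < δ / 2 by positivity))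
  refine ⟨max M N, fun n hn => ?_⟩
  have h1 := hb n (le_of_max_le_right hn)
  have h2 := hM n (le_of_max_le_left hn)
  rw [Real.dist_eq, sub_zero, abs_of_nonneg (hz n)]
  linarith

lemma g_rec (p : ℕ → ℝ) (hp : ∀ n, 0 < p n) (n : ℕ) :
    pD p (n + 1) / pQ p (n + 1) =
      (pD p n / pQ p n + p (n + 1) / pQ p (n + 1)) / (1 + pD p n / pQ p n) := by
  have h1 := pQ_pos p hp n
  have h2 := pQ_pos p hp (n + 1)
  have h3 := pD_pos p hp n
  have h4 : 0 < pQ p n + pD p n := by linarith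
  have e1 := pQ_succ p n
  rw [pD_succ] at e1 ⊢
  field_simp
  rw [e1]; ring

set_option maxHeartbeats 1000000 in
lemma riccati_step (c s s' K G g' : ℝ) (hc : 0 < c) (hK : 0 ≤ K) (hG0 : 0 < G)
    (hs1 : 1 ≤ s) (hle : s ≤ s') (hss' : s' ^ 2 = s ^ 2 + 1) (ha : K / s' ^ 2 ≤ 1)
    (hs : c + 2 / c ≤ s) (hrec : g' = (G + K / s' ^ 2) / (1 + G)) :
    s' * |g' - c / s'| ≤ (1 - c / (4 * s)) * (s * |G - c / s|) +
      c / (4 * s) * (4 / c * (|K - c ^ 2| + c ^ 2 * (1 / s ^ 2) + 2 * c * (1 / s))) := by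
  have hs0 : 0 < s := by linarith
  have hs0' : 0 < s' := by linarith
  obtain ⟨y, hy⟩ : ∃ y, y = c / s := ⟨_, rfl⟩
  obtain ⟨y', hy'⟩ : ∃ y', y' = c / s' := ⟨_, rfl⟩
  obtain ⟨a, hadef⟩ : ∃ a, a = K / s' ^ 2 := ⟨_, rfl⟩
  rw [← hadef] at ha
  have ha0 : 0 ≤ a := by rw [hadef]; positivity
  rw [← hy, ← hy']
  have hy0 : 0 < y := by rw [hy]; positivity
  have hy0' : 0 < y' := by rw [hy']; positivity
  have hdiff : g' - y' = (G - y) * (1 - a) / ((1 + G) * (1 + y))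
      + (y - y' + a - y' * y) / (1 + y) := by
    rw [hrec, ← hadef]
    field_simp
    ring
  have hA : |(G - y) * (1 - a) / ((1 + G) * (1 + y))| ≤ |G - y| / (1 + y) := by
    rw [abs_div, abs_mul, abs_of_nonneg (show 0 ≤ 1 - a by linarith),
      abs_of_pos (show 0 < (1 + G) * (1 + y) by positivity)]
    rw [div_le_div_iff₀ (by positivity) (by positivity)]
    have h1 : (1 - a) ≤ 1 + G := by linarith
    have : |G - y| * (1 - a) * (1 + y) ≤ |G - y| * (1 + G) * (1 + y) := by gcongr
    linarith
  have hdel : s' - s ≤ 1 / (2 * s) := by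
    rw [le_div_iff₀ (by positivity)]
    nlinarith
  have hyy : y - y' = c * (s' - s) / (s * s') := by
    rw [hy, hy']; field_simp
  have hyy0 : 0 ≤ y - y' := by
    rw [hyy]; have : 0 ≤ s' - s := by linarith
    positivity
  -- error
  have hE : |(y - y' + a - y' * y) / (1 + y)| ≤ (y - y') + |a - y' * y| := by
    rw [abs_div, abs_of_pos (show 0 < 1 + y by positivity)]
    refine (div_le_self (abs_nonneg _) (by linarith)).trans ?_
    rw [add_sub_assoc]
    refine (abs_add_le _ _).trans ?_
    rw [abs_of_nonneg hyy0]
  have hay : |a - y' * y| ≤ |K - c ^ 2| / s' ^ 2 + c ^ 2 / (s ^ 2 * s' ^ 2) := by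
    have e1 : a - y' * y = (K - c ^ 2) / s' ^ 2 +
        (c ^ 2 / s' ^ 2 - y' * y) := by
      rw [hadef]; ring
    rw [e1]
    refine (abs_add_le _ _).trans ?_
    rw [abs_div, abs_of_pos (show 0 < s' ^ 2 by positivity)]
    refine add_le_add le_rfl ?_
    have e2 : y' * y - c ^ 2 / s' ^ 2 = c ^ 2 * (s' - s) / (s * s' ^ 2) := by
      rw [hy, hy']; field_simp
    rw [abs_sub_comm, e2, abs_of_nonneg (by
      have : 0 ≤ s' - s := by linarith
      positivity)]
    rw [div_le_div_iff₀ (by positivity) (by positivity)]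
    have h2 : (s' - s) * s ≤ 1 := by nlinarith
    have : c ^ 2 * s * s' ^ 2 * ((s' - s) * s) ≤ c ^ 2 * s * s' ^ 2 * 1 := by gcongr
    nlinarith
  have htot : |g' - y'| ≤ |G - y| / (1 + y) + ((y - y') +
      (|K - c ^ 2| / s' ^ 2 + c ^ 2 / (s ^ 2 * s' ^ 2))) := by
    rw [hdiff]
    refine (abs_add_le _ _).trans ?_
    linarith
  have hmul := mul_le_mul_of_nonneg_left htot hs0'.le
  refine hmul.trans ?_
  rw [mul_add]
  refine add_le_add ?_ ?_
  · -- main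
    have h3 : s' / (1 + y) ≤ (1 - c / (4 * s)) * s := by
      rw [div_le_iff₀ (by positivity)]
      have hcs : c ≤ s := by
        have : 0 < 2 / c := by positivity
        linarith
      have hcs2 : 2 ≤ c * s := by
        have h6 : 2 / c ≤ s := by linarith
        rw [div_le_iff₀ hc] at h6; linarith
      have e3 : (1 - c / (4 * s)) * s * (1 + y) = (s - c / 4) * (1 + c / s) := by
        rw [hy]; field_simp
      rw [e3]
      have e4 : (s - c / 4) * (1 + c / s) = s + (3 / 4 * c - c * c / (4 * s)) := by
        field_simp; ring
      rw [e4]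
      have h7 : c * c / (4 * s) ≤ c / 4 := by
        rw [div_le_div_iff₀ (by positivity) (by positivity)]; nlinarith
      have h8 : 1 / (2 * s) ≤ c / 4 := by
        rw [div_le_div_iff₀ (by positivity) (by positivity)]; nlinarith
      linarith
    calc s' * (|G - y| / (1 + y)) = s' / (1 + y) * |G - y| := by ring
      _ ≤ (1 - c / (4 * s)) * s * |G - y| := by gcongr
      _ = _ := by ring
  · have e5 : c / (4 * s) * (4 / c * (|K - c ^ 2| + c ^ 2 * (1 / s ^ 2) +
        2 * c * (1 / s))) =
        2 * c / s ^ 2 + (|K - c ^ 2| / s + c ^ 2 / (s ^ 2 * s)) := by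
      field_simp; ring
    rw [e5]
    have t1 : s' * (y - y') ≤ 2 * c / s ^ 2 := by
      rw [hyy]
      have : s' * (c * (s' - s) / (s * s')) = c * (s' - s) / s := by field_simp
      rw [this, div_le_div_iff₀ (by positivity) (by positivity)]
      have h2 : (s' - s) * s ≤ 2 := by nlinarith
      have : c * s * ((s' - s) * s) ≤ c * s * 2 := by gcongr
      nlinarith
    have t2 : s' * (|K - c ^ 2| / s' ^ 2) ≤ |K - c ^ 2| / s := by
      have : s' * (|K - c ^ 2| / s' ^ 2) = |K - c ^ 2| / s' := by
        field_simp
      rw [this]; gcongr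
    have t3 : s' * (c ^ 2 / (s ^ 2 * s' ^ 2)) ≤ c ^ 2 / (s ^ 2 * s) := by
      have : s' * (c ^ 2 / (s ^ 2 * s' ^ 2)) = c ^ 2 / (s ^ 2 * s') := by
        field_simp
      rw [this]; gcongr
    linarith

lemma riccati_tendsto (g kap : ℕ → ℝ) (c : ℝ) (hc : 0 < c) (hg : ∀ n, 0 < g n)
    (hk0 : ∀ n, 0 ≤ kap n)
    (hk : Tendsto kap atTop (nhds (c ^ 2)))
    (hrec : ∀ n : ℕ, g (n + 1) = (g n + kap (n + 1) / ((n + 1 : ℕ) : ℝ)) / (1 + g n)) :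
    Tendsto (fun n : ℕ => Real.sqrt n * g n) atTop (nhds c) := by
  have hsq : Tendsto (fun n : ℕ => Real.sqrt (n : ℝ)) atTop atTop :=
    Real.tendsto_sqrt_atTop.comp tendsto_natCast_atTop_atTop
  have hz : Tendsto (fun k : ℕ => Real.sqrt k * |g k - c / Real.sqrt k|) atTop (nhds 0) := by
    refine contraction_tendsto _ (fun k => c / (4 * Real.sqrt k))
      (fun k => 4 / c * (|kap (k + 1) - c ^ 2| + c ^ 2 * (1 / (k : ℝ)) +
        2 * c * (1 / Real.sqrt k)))
      (fun k => by positivity) ?_ ?_ ?_ ?_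
    · have hkk : ∀ᶠ k : ℕ in atTop, kap (k + 1) / ((k + 1 : ℕ) : ℝ) ≤ 1 := by
        have h1 : Tendsto (fun k : ℕ => kap (k + 1) / ((k + 1 : ℕ) : ℝ)) atTop (nhds 0) :=
          (hk.div_atTop tendsto_natCast_atTop_atTop).comp (tendsto_add_atTop_nat 1)
        exact h1.eventually_le_const (by norm_num)
      filter_upwards [eventually_ge_atTop 1, hkk, hsq.eventually_ge_atTop (c + 2 / c)]
        with k hk1 ha hs
      have hkr : (1 : ℝ) ≤ k := by exact_mod_cast hk1
      have hss : Real.sqrt (k : ℝ) ^ 2 = k := Real.sq_sqrt (by positivity)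
      have hss' : Real.sqrt ((k + 1 : ℕ) : ℝ) ^ 2 = ((k + 1 : ℕ) : ℝ) :=
        Real.sq_sqrt (by positivity)
      have hst := riccati_step c (Real.sqrt k) (Real.sqrt ((k + 1 : ℕ) : ℝ)) (kap (k + 1)) (g k)
        (g (k + 1)) hc (hk0 _) (hg k) (Real.one_le_sqrt.2 hkr)
        (Real.sqrt_le_sqrt (by push_cast; linarith)) (by rw [hss, hss']; push_cast; ring)
        (by rw [hss']; exact ha) hs (by rw [hss']; exact hrec k)
      rw [hss] at hst
      exact hst
    · filter_upwards [hsq.eventually_ge_atTop c, hsq.eventually_ge_atTop 1] with k h1 h2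
      refine ⟨by positivity, ?_⟩
      rw [div_le_one (by positivity)]; linarith
    · have hns : ¬ Summable (fun k : ℕ => c / (4 * Real.sqrt k)) := by
        intro h
        have h1 : Summable (fun k : ℕ => 1 / (k : ℝ) ^ (1 / 2 : ℝ)) := by
          refine (h.mul_left (4 / c)).congr fun k => ?_
          rw [← Real.sqrt_eq_rpow]
          rcases eq_or_ne (Real.sqrt (k : ℝ)) 0 with h0 | h0
          · simp [h0]
          · field_simp
        rw [Real.summable_one_div_nat_rpow] at h1
        norm_num at h1
      exact (not_summable_iff_tendsto_nat_atTop_of_nonneg (fun k => by positivity)).1 hns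
    · have h1 : Tendsto (fun k : ℕ => |kap (k + 1) - c ^ 2|) atTop (nhds 0) := by
        have := ((hk.comp (tendsto_add_atTop_nat 1)).sub_const (c ^ 2)).abs
        simpa using this
      have h2 : Tendsto (fun k : ℕ => (1 : ℝ) / k) atTop (nhds 0) :=
        tendsto_one_div_atTop_nhds_zero_nat
      have h3 : Tendsto (fun k : ℕ => (1 : ℝ) / Real.sqrt k) atTop (nhds 0) :=
        tendsto_const_nhds.div_atTop hsq
      have := (((h1.add (h2.const_mul (c ^ 2))).add (h3.const_mul (2 * c))).const_mul (4 / c))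
      simpa using this
  rw [tendsto_iff_norm_sub_tendsto_zero]
  refine hz.congr' ?_
  filter_upwards [hsq.eventually_ge_atTop 1] with k h1
  have h2 : 0 < Real.sqrt (k : ℝ) := by linarith
  have : Real.sqrt k * g k - c = Real.sqrt k * (g k - c / Real.sqrt k) := by
    field_simp
  rw [this, Real.norm_eq_abs, abs_mul, abs_of_pos h2]

lemma g_tendsto (p : ℕ → ℝ) (hp : ∀ n, 0 < p n) (c : ℝ) (hc : 0 < c)
    (hk : Tendsto (fun n : ℕ => (n : ℝ) * p n / pQ p n) atTop (nhds (c ^ 2))) :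
    Tendsto (fun n : ℕ => Real.sqrt n * (pD p n / pQ p n)) atTop (nhds c) := by
  refine riccati_tendsto _ (fun n : ℕ => (n : ℝ) * p n / pQ p n) c hc
    (fun n => div_pos (pD_pos p hp n) (pQ_pos p hp n))
    (fun n => ?_) hk fun n => ?_
  · have := hp n
    have := pQ_pos p hp n
    positivity
  · rw [g_rec p hp n]
    congr 2
    have : ((n + 1 : ℕ) : ℝ) ≠ 0 := by positivity
    field_simp

lemma sqrt_nat_tendsto : Tendsto (fun n : ℕ => Real.sqrt (n : ℝ)) atTop atTop :=
  Real.tendsto_sqrt_atTop.comp tendsto_natCast_atTop_atTop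

lemma Q_upper (p : ℕ → ℝ) (hp : ∀ n, 0 < p n) (c : ℝ)
    (hg : Tendsto (fun n : ℕ => Real.sqrt n * (pD p n / pQ p n)) atTop (nhds c))
    (ε : ℝ) (hε : 0 < ε) (hεc : ε ≤ c) :
    ∃ n0 : ℕ, ∀ n s : ℕ, n0 + s ≤ n →
      pQ p (n - s) ≤ Real.exp (-((c - ε) * s / Real.sqrt n)) * pQ p n := by
  have h1 : ∀ᶠ n : ℕ in atTop, c - ε < Real.sqrt n * (pD p n / pQ p n) :=
    hg.eventually_const_lt (by linarith)
  obtain ⟨n0, hn0⟩ := eventually_atTop.1 (h1.and (eventually_ge_atTop 1))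
  refine ⟨n0, fun n s => ?_⟩
  induction s with
  | zero => intro _; simp
  | succ s ih =>
    intro hs
    have ih := ih (by omega)
    obtain ⟨hj, hj1⟩ := hn0 (n - s) (by omega)
    set j := n - s with hjd
    have hjn : n - (s + 1) = j - 1 := by omega
    rw [hjn]
    have hQ := pQ_pos p hp j
    have e1 : pQ p (j - 1) = pQ p j * (1 - pD p j / pQ p j) := by
      have := pQ_succ p (j - 1)
      rw [Nat.sub_add_cancel hj1] at this
      field_simp
      linarith
    have hj0 : (0 : ℝ) < j := by exact_mod_cast hj1
    have hle : (c - ε) / Real.sqrt n ≤ pD p j / pQ p j := by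
      have h2 : (c - ε) / Real.sqrt j ≤ pD p j / pQ p j := by
        rw [div_le_iff₀ (Real.sqrt_pos.2 hj0)]; linarith
      refine le_trans ?_ h2
      have : Real.sqrt j ≤ Real.sqrt n := Real.sqrt_le_sqrt (by exact_mod_cast Nat.sub_le n s)
      have h0 := Real.sqrt_pos.2 hj0
      exact div_le_div_of_nonneg_left (by linarith) h0 this
    have e2 : -((c - ε) * ((s + 1 : ℕ) : ℝ) / Real.sqrt n)
        = -((c - ε) / Real.sqrt n) + -((c - ε) * s / Real.sqrt n) := by
      push_cast; ring
    rw [e2, Real.exp_add, e1]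
    have h3 : 1 - pD p j / pQ p j ≤ Real.exp (-((c - ε) / Real.sqrt n)) := by
      have := Real.add_one_le_exp (-((c - ε) / Real.sqrt n))
      linarith
    calc pQ p j * (1 - pD p j / pQ p j) ≤ pQ p j * Real.exp (-((c - ε) / Real.sqrt n)) := by
          gcongr
      _ ≤ (Real.exp (-((c - ε) * s / Real.sqrt n)) * pQ p n) *
          Real.exp (-((c - ε) / Real.sqrt n)) := by gcongr
      _ = _ := by ring

lemma Q_lower (p : ℕ → ℝ) (hp : ∀ n, 0 < p n) (c : ℝ) (hc : 0 < c)
    (hg : Tendsto (fun n : ℕ => Real.sqrt n * (pD p n / pQ p n)) atTop (nhds c))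
    (ε : ℝ) (hε : 0 < ε) :
    ∃ n0 : ℕ, ∃ δ : ℝ, 0 < δ ∧ ∀ n s : ℕ, n0 + s ≤ n → (s : ℝ) ≤ δ * n →
      Real.exp (-((c + ε) * s / Real.sqrt n)) * pQ p n ≤ pQ p (n - s) := by
  have h1 : ∀ᶠ n : ℕ in atTop, Real.sqrt n * (pD p n / pQ p n) *
      (1 + (c + ε / 2) / Real.sqrt n) < c + ε / 2 := by
    have : Tendsto (fun n : ℕ => Real.sqrt n * (pD p n / pQ p n) *
      (1 + (c + ε / 2) / Real.sqrt n)) atTop (nhds (c * (1 + 0))) :=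
      hg.mul (tendsto_const_nhds.add (tendsto_const_nhds.div_atTop sqrt_nat_tendsto))
    exact this.eventually_lt_const (by linarith)
  obtain ⟨n0, hn0⟩ := eventually_atTop.1 (h1.and (eventually_ge_atTop 1))
  set θ : ℝ := (c + ε / 2) / (c + ε) with hθ
  have hθ0 : 0 < θ := by positivity
  have hθ1 : θ < 1 := by rw [hθ, div_lt_one (by positivity)]; linarith
  refine ⟨n0, 1 - θ ^ 2, by nlinarith, fun n s => ?_⟩
  induction s with
  | zero => intro _ _; simp
  | succ s ih =>
    intro hs hs2
    have ih := ih (by omega) (by push_cast at hs2; linarith)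
    obtain ⟨hj, hj1⟩ := hn0 (n - s) (by omega)
    have hjc : ((n - s : ℕ) : ℝ) = n - s := by rw [Nat.cast_sub (by omega)]
    set j := n - s with hjd
    have hjn : n - (s + 1) = j - 1 := by omega
    rw [hjn]
    have hQ := pQ_pos p hp j
    have e1 : pQ p (j - 1) = pQ p j * (1 - pD p j / pQ p j) := by
      have := pQ_succ p (j - 1)
      rw [Nat.sub_add_cancel hj1] at this
      field_simp
      linarith
    have hj0 : (0 : ℝ) < j := by exact_mod_cast hj1
    have hsj := Real.sqrt_pos.2 hj0
    have hn1 : (0 : ℝ) < n := by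
      have : 0 < n := by omega
      exact_mod_cast this
    have hsn := Real.sqrt_pos.2 hn1
    have hsq : θ * Real.sqrt n ≤ Real.sqrt j := by
      apply Real.le_sqrt_of_sq_le
      rw [mul_pow, Real.sq_sqrt hn1.le, hjc]
      push_cast at hs2
      nlinarith
    have hx : (c + ε / 2) / Real.sqrt j ≤ (c + ε) / Real.sqrt n := by
      rw [div_le_div_iff₀ hsj hsn]
      have : (c + ε) * (θ * Real.sqrt n) ≤ (c + ε) * Real.sqrt j := by gcongr
      have e : (c + ε) * (θ * Real.sqrt n) = (c + ε / 2) * Real.sqrt n := by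
        rw [hθ]; field_simp
      linarith
    have h3 : Real.exp (-((c + ε) / Real.sqrt n)) ≤ 1 - pD p j / pQ p j := by
      have hx2 : Real.exp (-((c + ε) / Real.sqrt n)) ≤ Real.exp (-((c + ε / 2) / Real.sqrt j)) :=
        Real.exp_le_exp.2 (by linarith)
      refine hx2.trans ?_
      set x := (c + ε / 2) / Real.sqrt j with hxd
      have hx0 : 0 < x := by positivity
      have hgx : pD p j / pQ p j * (1 + x) ≤ x := by
        rw [hxd, le_div_iff₀ hsj, ← hxd]; linarith
      have h4 : Real.exp (-x) ≤ 1 / (1 + x) := by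
        rw [Real.exp_neg, inv_eq_one_div]
        have := Real.add_one_le_exp x
        exact one_div_le_one_div_of_le (by positivity) (by linarith)
      refine h4.trans ?_
      rw [div_le_iff₀ (by positivity)]
      nlinarith
    have e2 : -((c + ε) * ((s + 1 : ℕ) : ℝ) / Real.sqrt n)
        = -((c + ε) / Real.sqrt n) + -((c + ε) * s / Real.sqrt n) := by
      push_cast; ring
    rw [e2, Real.exp_add, e1]
    calc _ = (Real.exp (-((c + ε) * s / Real.sqrt n)) * pQ p n) *
          Real.exp (-((c + ε) / Real.sqrt n)) := by ring
      _ ≤ pQ p j * Real.exp (-((c + ε) / Real.sqrt n)) := by gcongr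
      _ ≤ _ := by gcongr

lemma kappa_ratio (k : ℕ → ℝ) (z : ℝ) (hz : 0 < z) (hk : Tendsto k atTop (nhds z))
    (ε : ℝ) (hε : 0 < ε) : ∃ n0 : ℕ, ∀ a b : ℕ, n0 ≤ a → n0 ≤ b → k a ≤ (1 + ε) * k b := by
  set r : ℝ := Real.sqrt (1 + ε) with hr
  have hr1 : 1 < r := by rw [hr]; exact Real.lt_sqrt_of_sq_lt (by linarith)
  have hr2 : r * r = 1 + ε := Real.mul_self_sqrt (by linarith)
  have h1 : ∀ᶠ n in atTop, k n < r * z := hk.eventually_lt_const (by nlinarith)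
  have h2 : ∀ᶠ n in atTop, z / r < k n :=
    hk.eventually_const_lt (by rw [div_lt_iff₀ (by linarith)]; nlinarith)
  obtain ⟨n0, hn0⟩ := eventually_atTop.1 (h1.and h2)
  refine ⟨n0, fun a b ha hb => ?_⟩
  have h3 := (hn0 a ha).1
  have h4 := (hn0 b hb).2
  rw [div_lt_iff₀ (by linarith)] at h4
  rw [← hr2]
  nlinarith

lemma ratio_upper (p : ℕ → ℝ) (hp : ∀ n, 0 < p n) (hm : Monotone p) (c : ℝ) (hc : 0 < c)
    (hk : Tendsto (fun n : ℕ => (n : ℝ) * p n / pQ p n) atTop (nhds (c ^ 2)))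
    (hg : Tendsto (fun n : ℕ => Real.sqrt n * (pD p n / pQ p n)) atTop (nhds c))
    (η : ℝ) (hη : 0 < η) (hηc : η < c) :
    ∀ᶠ n : ℕ in atTop, ∀ s : ℕ, s ≤ n →
      p (n - s) ≤ (1 + η) * Real.exp (-((c - η) * s / Real.sqrt n)) * p n := by
  set ε := η / 3 with hεd
  have hε : 0 < ε := by positivity
  obtain ⟨n1, hn1⟩ := Q_upper p hp c hg ε hε (by rw [hεd]; linarith)
  obtain ⟨n2, hn2⟩ := kappa_ratio _ _ (by positivity) hk ε hε
  set n0 := max (max n1 n2) 1 with hn0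
  set δ : ℝ := η / (3 * (1 + η)) with hδd
  have hδ0 : 0 < δ := by positivity
  have hδη : (1 + η) * (1 - δ) = 1 + 2 * ε := by rw [hδd, hεd]; field_simp; ring
  have hδ1 : δ < 1 := by
    have : 0 < (1 + η) * (1 - δ) := by rw [hδη]; positivity
    nlinarith
  -- basic
  have hbase : ∀ n s : ℕ, n0 + s ≤ n → p (n - s) * (n - s : ℝ) ≤
      (1 + ε) * Real.exp (-((c - ε) * s / Real.sqrt n)) * p n * n := by
    intro n s hs
    have h1 := hn1 n s (by omega)
    have h2 := hn2 (n - s) n (by omega) (by omega)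
    have hQ1 := pQ_pos p hp n
    have hQ2 := pQ_pos p hp (n - s)
    rw [Nat.cast_sub (by omega), div_le_iff₀ hQ2] at h2
    have h3 : (1 + ε) * ((n : ℝ) * p n / pQ p n) * pQ p (n - s) ≤
        (1 + ε) * ((n : ℝ) * p n / pQ p n) *
          (Real.exp (-((c - ε) * s / Real.sqrt n)) * pQ p n) := by
      have := hp n
      gcongr
    have h4 : (1 + ε) * ((n : ℝ) * p n / pQ p n) *
          (Real.exp (-((c - ε) * s / Real.sqrt n)) * pQ p n) =
          (1 + ε) * Real.exp (-((c - ε) * s / Real.sqrt n)) * p n * n := by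
      field_simp
    linarith
  have hlog : ∀ᶠ n : ℕ in atTop, (n : ℝ) ≤ Real.exp (ε * δ * Real.sqrt n) := by
    have h1 : Tendsto (fun x : ℝ => x ^ 2 / Real.exp (ε * δ * x)) atTop (nhds 0) := by
      have := tendsto_rpow_mul_exp_neg_mul_atTop_nhds_zero 2 (ε * δ) (by positivity)
      refine this.congr fun x => ?_
      rw [neg_mul, Real.exp_neg, Real.rpow_ofNat]; rfl
    have h2 := (h1.comp sqrt_nat_tendsto).eventually_le_const (show (0 : ℝ) < 1 by norm_num)
    filter_upwards [h2] with n hn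
    simp only [Function.comp] at hn
    rwa [Real.sq_sqrt (by positivity), div_le_one (Real.exp_pos _)] at hn
  have hbig : ∀ᶠ n : ℕ in atTop, (c + 1) * (n0 : ℝ) ≤ ε * n ∧ (n0 : ℝ) + 1 ≤ (1 - δ) * n := by
    have t1 : Tendsto (fun n : ℕ => ε * (n : ℝ)) atTop atTop :=
      tendsto_natCast_atTop_atTop.const_mul_atTop hε
    have t2 : Tendsto (fun n : ℕ => (1 - δ) * (n : ℝ)) atTop atTop :=
      tendsto_natCast_atTop_atTop.const_mul_atTop (by linarith)
    exact (t1.eventually_ge_atTop _).and (t2.eventually_ge_atTop _)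
  filter_upwards [hlog, hbig, eventually_ge_atTop 1] with n hnl ⟨hnb1, hnb2⟩ hn1
  have hnr : (0 : ℝ) < n := by exact_mod_cast hn1
  have hsn := Real.sqrt_pos.2 hnr
  have hpn := hp n
  -- case B
  have hB : ∀ s : ℕ, n0 + s ≤ n → δ * n ≤ s →
      p (n - s) ≤ (1 + ε) * Real.exp (-((c - 2 * ε) * s / Real.sqrt n)) * p n := by
    intro s hs hδs
    have h1 := hbase n s hs
    have hs1 : (1 : ℝ) ≤ n - s := by
      have : s + 1 ≤ n := by omega
      have : (s : ℝ) + 1 ≤ n := by exact_mod_cast this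
      linarith
    have h2 : p (n - s) ≤ p (n - s) * (n - s : ℝ) := le_mul_of_one_le_right (hp _).le hs1
    refine h2.trans (h1.trans ?_)
    have h3 : (n : ℝ) ≤ Real.exp (ε * s / Real.sqrt n) := by
      refine hnl.trans (Real.exp_le_exp.2 ?_)
      rw [le_div_iff₀ hsn]
      have : ε * δ * Real.sqrt n * Real.sqrt n = ε * (δ * n) := by
        rw [mul_assoc, Real.mul_self_sqrt hnr.le]; ring
      rw [this]; gcongr
    have e : Real.exp (-((c - 2 * ε) * s / Real.sqrt n)) =
        Real.exp (-((c - ε) * s / Real.sqrt n)) * Real.exp (ε * s / Real.sqrt n) := by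
      rw [← Real.exp_add]; congr 1; ring
    rw [e]
    calc (1 + ε) * Real.exp (-((c - ε) * s / Real.sqrt n)) * p n * n
        ≤ (1 + ε) * Real.exp (-((c - ε) * s / Real.sqrt n)) * p n *
          Real.exp (ε * s / Real.sqrt n) := by gcongr
      _ = _ := by ring
  have hexp : ∀ s : ℕ, ∀ e' ≤ 3 * ε, Real.exp (-((c - e') * s / Real.sqrt n)) ≤
      Real.exp (-((c - η) * s / Real.sqrt n)) := by
    intro s e' he'
    refine Real.exp_le_exp.2 (neg_le_neg ?_)
    have : c - η ≤ c - e' := by rw [hεd] at he'; linarith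
    gcongr
  intro s hsn'
  by_cases hs : n0 + s ≤ n
  · by_cases hd : δ * n ≤ s
    · refine (hB s hs hd).trans ?_
      have := hexp s (2 * ε) (by linarith)
      have : 1 + ε ≤ 1 + η := by rw [hεd]; linarith
      gcongr
    · push Not at hd
      have h1 := hbase n s hs
      have h2 : p (n - s) * ((1 - δ) * n) ≤ p (n - s) * (n - s : ℝ) := by
        have := (hp (n - s)).le
        gcongr; linarith
      have h3 := h2.trans h1
      have h4 : (1 + ε) * Real.exp (-((c - ε) * s / Real.sqrt n)) * p n * n ≤
          ((1 + η) * (1 - δ)) * Real.exp (-((c - η) * s / Real.sqrt n)) * p n * n := by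
        have := hexp s ε (by linarith)
        rw [hδη]
        gcongr; linarith
      have h5 : p (n - s) * ((1 - δ) * n) ≤
        ((1 + η) * Real.exp (-((c - η) * s / Real.sqrt n)) * p n) * ((1 - δ) * n) := by
        refine h3.trans (h4.trans (le_of_eq ?_)); ring
      exact le_of_mul_le_mul_right h5 (by
        have : 0 < 1 - δ := by linarith
        positivity)
  · have hn0n : n0 ≤ n := by
      have : (n0 : ℝ) ≤ n := by nlinarith
      exact_mod_cast this
    have h1 := hB (n - n0) (by omega) (by rw [Nat.cast_sub hn0n]; linarith)
    have h2 : p (n - s) ≤ p (n - (n - n0)) := hm (by omega)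
    refine h2.trans (h1.trans ?_)
    have h3 : Real.exp (-((c - 2 * ε) * (n - n0 : ℕ) / Real.sqrt n)) ≤
        Real.exp (-((c - η) * s / Real.sqrt n)) := by
      refine Real.exp_le_exp.2 (neg_le_neg ?_)
      have hsr : (s : ℝ) ≤ n := by exact_mod_cast hsn'
      have : (c - η) * s ≤ (c - η) * n := by
        have : 0 ≤ c - η := by linarith
        gcongr
      have e : c - η = c - 3 * ε := by rw [hεd]; ring
      have : (c - η) * s ≤ (c - 2 * ε) * (n - n0 : ℕ) := by
        rw [Nat.cast_sub hn0n]
        refine this.trans ?_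
        rw [e]
        have : 0 ≤ (n0 : ℝ) := by positivity
        nlinarith
      gcongr
    have : 1 + ε ≤ 1 + η := by rw [hεd]; linarith
    gcongr

lemma ratio_lower (p : ℕ → ℝ) (hp : ∀ n, 0 < p n) (c : ℝ) (hc : 0 < c)
    (hk : Tendsto (fun n : ℕ => (n : ℝ) * p n / pQ p n) atTop (nhds (c ^ 2)))
    (hg : Tendsto (fun n : ℕ => Real.sqrt n * (pD p n / pQ p n)) atTop (nhds c))
    (η R : ℝ) (hη : 0 < η) (hR : 0 < R) :
    ∀ᶠ n : ℕ in atTop, ∀ s : ℕ, (s : ℝ) ≤ R * Real.sqrt n →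
      s ≤ n ∧ Real.exp (-((c + η) * s / Real.sqrt n)) * p n ≤ (1 + η) * p (n - s) := by
  obtain ⟨n1, δ, hδ, hn1⟩ := Q_lower p hp c hc hg η hη
  obtain ⟨n2, hn2⟩ := kappa_ratio _ _ (by positivity) hk η hη
  have h1 := sqrt_nat_tendsto.eventually_ge_atTop (R / δ)
  have h2 := sqrt_nat_tendsto.eventually_ge_atTop (R + (n1 + n2 + 1 : ℕ))
  filter_upwards [h1, h2, eventually_ge_atTop 1] with n h1 h2 hn
  intro s hs
  have hnr : (1 : ℝ) ≤ n := by exact_mod_cast hn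
  have hs1 : 1 ≤ Real.sqrt n := Real.one_le_sqrt.2 hnr
  have hsq : Real.sqrt n * Real.sqrt n = n := Real.mul_self_sqrt (by linarith)
  have hns : (n1 + n2 + 1) + s ≤ n := by
    have : (((n1 + n2 + 1 : ℕ) : ℝ)) + s ≤ n := by
      have h3 : (0 : ℝ) ≤ ((n1 + n2 + 1 : ℕ) : ℝ) := by positivity
      nlinarith
    exact_mod_cast this
  refine ⟨by omega, ?_⟩
  have hQl := hn1 n s (by omega) (by
    rw [div_le_iff₀ hδ] at h1
    nlinarith)
  have hkr := hn2 n (n - s) (by omega) (by omega)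
  have hQ1 := pQ_pos p hp n
  have hQ2 := pQ_pos p hp (n - s)
  have hns0 : (0 : ℝ) < ((n - s : ℕ) : ℝ) := by
    have : 0 < n - s := by omega
    exact_mod_cast this
  have hnsle : ((n - s : ℕ) : ℝ) ≤ n := by exact_mod_cast Nat.sub_le n s
  have hpn := hp n
  have hpns := hp (n - s)
  rw [div_le_iff₀ hQ1] at hkr
  have e1 : Real.exp (-((c + η) * s / Real.sqrt n)) * ((n : ℝ) * p n) ≤
      (1 + η) * (((n - s : ℕ) : ℝ) * p (n - s) / pQ p (n - s)) *
        (Real.exp (-((c + η) * s / Real.sqrt n)) * pQ p n) := by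
    calc _ ≤ Real.exp (-((c + η) * s / Real.sqrt n)) *
        ((1 + η) * (((n - s : ℕ) : ℝ) * p (n - s) / pQ p (n - s)) * pQ p n) := by gcongr
      _ = _ := by ring
  have e2 : (1 + η) * (((n - s : ℕ) : ℝ) * p (n - s) / pQ p (n - s)) *
        (Real.exp (-((c + η) * s / Real.sqrt n)) * pQ p n) ≤
      (1 + η) * (((n - s : ℕ) : ℝ) * p (n - s) / pQ p (n - s)) * pQ p (n - s) := by gcongr
  have e3 : (1 + η) * (((n - s : ℕ) : ℝ) * p (n - s) / pQ p (n - s)) * pQ p (n - s) =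
      (1 + η) * p (n - s) * ((n - s : ℕ) : ℝ) := by field_simp
  have e4 : (1 + η) * p (n - s) * ((n - s : ℕ) : ℝ) ≤ (1 + η) * p (n - s) * n := by gcongr
  have e5 : (Real.exp (-((c + η) * s / Real.sqrt n)) * p n) * n ≤ (1 + η) * p (n - s) * n := by
    calc _ = Real.exp (-((c + η) * s / Real.sqrt n)) * ((n : ℝ) * p n) := by ring
      _ ≤ _ := by linarith
  exact le_of_mul_le_mul_right e5 (by linarith)

/-- The partition function. -/
def pt (n : ℕ) : ℕ := Fintype.card (Nat.Partition n)

lemma pt_pos (n : ℕ) : 0 < pt n := Fintype.card_pos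

lemma card_parts_ge (n : ℕ) (s : Multiset ℕ) (hs : ∀ i ∈ s, 0 < i) (hsum : s.sum ≤ n) :
    (Finset.univ.filter (fun μ : Nat.Partition n => s ≤ μ.parts)).card = pt (n - s.sum) := by
  classical
  unfold pt
  rw [← Finset.card_univ]
  refine Finset.card_bij' (fun μ hμ => ⟨μ.parts - s, ?_, ?_⟩)
    (fun ν _ => ⟨ν.parts + s, ?_, ?_⟩) ?_ ?_ ?_ ?_
  · intro i hi
    exact μ.parts_pos (Multiset.mem_of_le (Multiset.sub_le_self _ _) hi)
  · have h : s ≤ μ.parts := by simpa using hμ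
    have h2 := congrArg Multiset.sum (Multiset.sub_add_cancel h)
    rw [Multiset.sum_add, μ.parts_sum] at h2
    omega
  · intro i hi
    rcases Multiset.mem_add.1 hi with h | h
    · exact ν.parts_pos h
    · exact hs i h
  · rw [Multiset.sum_add, ν.parts_sum]; omega
  · intro μ _; simp
  · intro ν _; simp
  · intro μ hμ
    have h : s ≤ μ.parts := by simpa using hμ
    ext1
    exact Multiset.sub_add_cancel h
  · intro ν _
    ext1
    simp

lemma card_parts_ge_zero (n : ℕ) (s : Multiset ℕ) (hsum : n < s.sum) :
    (Finset.univ.filter (fun μ : Nat.Partition n => s ≤ μ.parts)).card = 0 := by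
  rw [Finset.card_eq_zero, Finset.filter_eq_empty_iff]
  intro μ _ h
  have h2 := congrArg Multiset.sum (Multiset.sub_add_cancel h)
  rw [Multiset.sum_add, μ.parts_sum] at h2
  omega

lemma pt_mono : Monotone pt := by
  refine monotone_nat_of_le_succ fun n => ?_
  have h := card_parts_ge (n + 1) {1} (by simp) (by simp)
  simp only [Multiset.sum_singleton, Nat.add_sub_cancel] at h
  rw [← h]
  exact Finset.card_le_univ _

lemma count_le_n {n : ℕ} (μ : Nat.Partition n) (d : ℕ) : μ.parts.count d * d ≤ n := by
  have h : Multiset.replicate (μ.parts.count d) d ≤ μ.parts :=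
    Multiset.le_count_iff_replicate_le.1 le_rfl
  have h2 := congrArg Multiset.sum (Multiset.sub_add_cancel h)
  rw [Multiset.sum_add, μ.parts_sum, Multiset.sum_replicate, smul_eq_mul] at h2
  omega

lemma count_eq_sum {n : ℕ} (μ : Nat.Partition n) (d : ℕ) (hd : 0 < d) :
    μ.parts.count d = ∑ j ∈ Finset.Icc 1 n,
      if Multiset.replicate j d ≤ μ.parts then 1 else 0 := by
  rw [← Finset.card_filter]
  have : (Finset.Icc 1 n).filter (fun j => Multiset.replicate j d ≤ μ.parts) =
      Finset.Icc 1 (μ.parts.count d) := by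
    ext j
    simp only [Finset.mem_filter, Finset.mem_Icc, ← Multiset.le_count_iff_replicate_le]
    have := count_le_n μ d
    have : μ.parts.count d ≤ n := by nlinarith
    omega
  rw [this]; simp

lemma pS_eq (n k : ℕ) (hk : k ≤ n) :
    pS k = ∑ d ∈ Finset.Icc 1 n, ∑ j ∈ Finset.Icc 1 n, if j * d ≤ k then d else 0 := by
  rw [Finset.sum_comm]
  unfold pS
  have h1 : ∀ j ∈ Finset.Icc 1 n, (∑ d ∈ Finset.Icc 1 n, if j * d ≤ k then d else 0)
      = ∑ d ∈ Finset.Icc 1 (k / j), d := by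
    intro j hj
    rw [← Finset.sum_filter]
    refine Finset.sum_congr ?_ fun _ _ => rfl
    ext d
    simp only [Finset.mem_filter, Finset.mem_Icc] at hj ⊢
    rw [Nat.le_div_iff_mul_le (by omega), mul_comm]
    constructor
    · rintro ⟨⟨h1, h2⟩, h3⟩; exact ⟨h1, h3⟩
    · rintro ⟨h1, h3⟩; exact ⟨⟨h1, by nlinarith⟩, h3⟩
  rw [Finset.sum_congr rfl h1]
  refine Finset.sum_subset (Finset.Icc_subset_Icc_right hk) fun j hj hj2 => ?_
  simp only [Finset.mem_Icc] at hj hj2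
  rw [Nat.div_eq_of_lt (by omega)]; simp

lemma pt_identity_nat (n : ℕ) : n * pt n = ∑ d ∈ Finset.Icc 1 n, ∑ j ∈ Finset.Icc 1 n,
    if j * d ≤ n then d * pt (n - j * d) else 0 := by
  classical
  have h1 : ∀ μ : Nat.Partition n, n = ∑ d ∈ Finset.Icc 1 n, ∑ j ∈ Finset.Icc 1 n,
      if Multiset.replicate j d ≤ μ.parts then d else 0 := by
    intro μ
    conv_lhs => rw [← μ.parts_sum]
    rw [Finset.sum_multiset_count_of_subset μ.parts (Finset.Icc 1 n)]
    · refine Finset.sum_congr rfl fun d hd => ?_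
      rw [count_eq_sum μ d (by simp at hd; omega), smul_eq_mul, Finset.sum_mul]
      refine Finset.sum_congr rfl fun j _ => ?_
      split_ifs <;> simp
    · intro d hd
      rw [Multiset.mem_toFinset] at hd
      have := μ.parts_pos hd
      have := μ.le_of_mem_parts hd
      simp; omega
  have h2 : n * pt n = ∑ μ : Nat.Partition n, n := by simp [pt, mul_comm]
  rw [h2, Finset.sum_congr rfl fun μ _ => h1 μ, Finset.sum_comm]
  refine Finset.sum_congr rfl fun d hd => ?_
  rw [Finset.sum_comm]
  refine Finset.sum_congr rfl fun j hj => ?_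
  rw [← Finset.sum_filter, Finset.sum_const, smul_eq_mul]
  split_ifs with h
  · rw [card_parts_ge n _ (by
      intro i hi
      rw [Multiset.eq_of_mem_replicate hi]
      simp at hd; omega) (by simpa using h)]
    simp [mul_comm]
  · rw [card_parts_ge_zero n _ (by simpa using h)]; simp

lemma pt_identity (n : ℕ) : (n : ℝ) * (pt n : ℝ) = ∑ i ∈ Finset.range (n + 1),
    pU (fun n => (pt n : ℝ)) i * (pS (n - i) : ℝ) := by
  have h := congrArg (Nat.cast : ℕ → ℝ) (pt_identity_nat n)
  push_cast at h
  rw [h]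
  have h1 : ∀ i ∈ Finset.range (n + 1), pU (fun n => (pt n : ℝ)) i * (pS (n - i) : ℝ) =
      ∑ d ∈ Finset.Icc 1 n, ∑ j ∈ Finset.Icc 1 n,
        if i + j * d ≤ n then (d : ℝ) * pU (fun n => (pt n : ℝ)) i else 0 := by
    intro i hi
    have hi' : i ≤ n := by simp at hi; omega
    rw [pS_eq n (n - i) (by omega)]
    push_cast
    rw [Finset.mul_sum]
    refine Finset.sum_congr rfl fun d _ => ?_
    rw [Finset.mul_sum]
    refine Finset.sum_congr rfl fun j _ => ?_
    have : j * d ≤ n - i ↔ i + j * d ≤ n := by omega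
    simp only [this]
    split_ifs
    · ring
    · simp
  rw [Finset.sum_congr rfl h1]
  conv_rhs => rw [Finset.sum_comm]
  refine Finset.sum_congr rfl fun d _ => ?_
  conv_rhs => rw [Finset.sum_comm]
  refine Finset.sum_congr rfl fun j _ => ?_
  split_ifs with hj
  · rw [← pU_sum (fun n => (pt n : ℝ)) (n - j * d), Finset.mul_sum, ← Finset.sum_filter]
    refine Finset.sum_congr ?_ fun _ _ => rfl
    ext i; simp only [Finset.mem_filter, Finset.mem_range]; omega
  · symm
    refine Finset.sum_eq_zero fun i _ => ?_
    rw [if_neg (by omega)]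

lemma pt_asymp : ∃ c : ℝ, 0 < c ∧
    (∀ η : ℝ, 0 < η → η < c → ∀ᶠ n : ℕ in atTop, ∀ s : ℕ, s ≤ n →
      (pt (n - s) : ℝ) ≤ (1 + η) * Real.exp (-((c - η) * s / Real.sqrt n)) * pt n) ∧
    (∀ η R : ℝ, 0 < η → 0 < R → ∀ᶠ n : ℕ in atTop, ∀ s : ℕ, (s : ℝ) ≤ R * Real.sqrt n →
      s ≤ n ∧ Real.exp (-((c + η) * s / Real.sqrt n)) * pt n ≤ (1 + η) * pt (n - s)) := by
  have hp : ∀ n, (0 : ℝ) < (fun n => (pt n : ℝ)) n := fun n => Nat.cast_pos.2 (pt_pos n)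
  have hm : Monotone (fun n => (pt n : ℝ)) := fun a b h => Nat.cast_le.2 (pt_mono h)
  obtain ⟨z, hz, hk⟩ := kappa_tendsto _ hp hm pt_identity
  have hc : 0 < Real.sqrt z := Real.sqrt_pos.2 hz
  rw [← Real.sq_sqrt hz.le] at hk
  have hg := g_tendsto _ hp _ hc hk
  exact ⟨Real.sqrt z, hc, fun η h1 h2 => ratio_upper _ hp hm _ hc hk hg η h1 h2,
    fun η R h1 h2 => ratio_lower _ hp _ hc hk hg η R h1 h2⟩

/-- Upper ratio bound at `n`. -/
def UB (c η : ℝ) (n : ℕ) : Prop := ∀ s : ℕ, s ≤ n →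
  (pt (n - s) : ℝ) ≤ (1 + η) * Real.exp (-((c - η) * s / Real.sqrt n)) * pt n
/-- Lower ratio bound at `n`. -/
def LB (c η R : ℝ) (n : ℕ) : Prop := ∀ s : ℕ, (s : ℝ) ≤ R * Real.sqrt n →
  s ≤ n ∧ Real.exp (-((c + η) * s / Real.sqrt n)) * pt n ≤ (1 + η) * pt (n - s)

lemma card_parts_le {c η : ℝ} {n : ℕ} (h : UB c η n) (hη : 0 < η) (s : Multiset ℕ)
    (hs : ∀ i ∈ s, 0 < i) :
    ((Finset.univ.filter (fun μ : Nat.Partition n => s ≤ μ.parts)).card : ℝ) ≤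
      (1 + η) * Real.exp (-((c - η) / Real.sqrt n * s.sum)) * pt n := by
  by_cases hsum : s.sum ≤ n
  · rw [card_parts_ge n s hs hsum]
    refine (h _ hsum).trans (le_of_eq ?_)
    congr 3; ring
  · rw [card_parts_ge_zero n s (by omega)]
    simp only [Nat.cast_zero]
    positivity

lemma geom_upper (b : ℝ) (hb : 0 < b) (d n : ℕ) (hd : 0 < d) :
    (d : ℝ) * ∑ j ∈ Finset.Icc 1 n, Real.exp (-(b * (j * d : ℕ))) ≤ 1 / b := by
  have hdr : (0 : ℝ) < d := by exact_mod_cast hd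
  set q := Real.exp (-(b * d)) with hq
  have hq0 : 0 < q := Real.exp_pos _
  have hbd : 0 < b * d := by positivity
  have hq1 : q < 1 := by rw [hq, Real.exp_lt_one_iff]; linarith
  have e1 : ∀ j : ℕ, Real.exp (-(b * (j * d : ℕ))) = q ^ j := by
    intro j
    rw [hq, ← Real.exp_nat_mul]; congr 1; push_cast; ring
  simp_rw [e1]
  have h1 : (1 - q) * ∑ j ∈ Finset.Icc 1 n, q ^ j = q - q ^ (n + 1) := by
    induction n with
    | zero => simp
    | succ k ih => rw [Finset.sum_Icc_succ_top (by omega), mul_add, ih]; ring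
  have h2 : q * (1 + b * d) ≤ 1 := by
    have h3 := Real.add_one_le_exp (b * d)
    have h4 : q * Real.exp (b * d) = 1 := by rw [hq, ← Real.exp_add]; simp
    have : q * (1 + b * d) ≤ q * Real.exp (b * d) := by gcongr; linarith
    linarith
  have h5 : b * d * q ≤ 1 - q := by linarith
  set S := ∑ j ∈ Finset.Icc 1 n, q ^ j with hS
  have hS0 : 0 ≤ S := Finset.sum_nonneg fun _ _ => by positivity
  rw [le_div_iff₀ hb]
  have h6 : b * d * q * S ≤ (1 - q) * S := by gcongr
  have h7 : 0 < q ^ (n + 1) := by positivity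
  have h8 : q * (b * d * S) ≤ q * 1 := by nlinarith
  have := le_of_mul_le_mul_left h8 hq0
  linarith

lemma second_moment {c η : ℝ} {n : ℕ} (h : UB c η n) (hη : 0 < η) (hηc : η < c) (hn : 0 < n)
    (d d' : ℕ) (hd : 0 < d) (hd' : 0 < d') :
    ∑ μ : Nat.Partition n, ((d : ℝ) * μ.parts.count d) * (d' * μ.parts.count d') ≤
      (if d = d' then 4 else 1) * ((1 + η) * (n / (c - η) ^ 2) * pt n) := by
  have hnr : (0 : ℝ) < n := by exact_mod_cast hn
  have hsn := Real.sqrt_pos.2 hnr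
  set b := (c - η) / Real.sqrt n with hb
  have hb0 : 0 < b := div_pos (by linarith) hsn
  have hbn : n / (c - η) ^ 2 = 1 / b * (1 / b) := by
    have : c - η ≠ 0 := by linarith
    rw [hb]; field_simp
    rw [Real.sq_sqrt hnr.le]
  set I : ℕ → ℕ → Nat.Partition n → ℝ := fun j e μ =>
    if Multiset.replicate j e ≤ μ.parts then 1 else 0 with hI
  have hc1 : ∀ (e : ℕ) (he : 0 < e) (μ : Nat.Partition n), (μ.parts.count e : ℝ) =
      ∑ j ∈ Finset.Icc 1 n, I j e μ := by
    intro e he μ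
    rw [count_eq_sum μ e he]; push_cast; rfl
  have key : ∑ μ : Nat.Partition n, ((d : ℝ) * μ.parts.count d) * (d' * μ.parts.count d') =
      d * d' * ∑ j ∈ Finset.Icc 1 n, ∑ j' ∈ Finset.Icc 1 n,
        ∑ μ : Nat.Partition n, I j d μ * I j' d' μ := by
    have hμ : ∀ μ : Nat.Partition n, ((d : ℝ) * μ.parts.count d) * (d' * μ.parts.count d') =
        d * d' * ∑ j ∈ Finset.Icc 1 n, ∑ j' ∈ Finset.Icc 1 n, I j d μ * I j' d' μ := by
      intro μ; rw [hc1 d hd, hc1 d' hd', ← Finset.sum_mul_sum]; ring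
    rw [Finset.sum_congr rfl fun μ _ => hμ μ, ← Finset.mul_sum, Finset.sum_comm]
    congr 1
    exact Finset.sum_congr rfl fun j _ => Finset.sum_comm
  have hfac : ∀ b' : ℝ, (d : ℝ) * d' * ∑ j ∈ Finset.Icc 1 n, ∑ j' ∈ Finset.Icc 1 n,
      ((1 + η) * (Real.exp (-(b' * (j * d : ℕ))) * Real.exp (-(b' * (j' * d' : ℕ)))) * pt n) =
      (1 + η) * pt n * ((d * ∑ j ∈ Finset.Icc 1 n, Real.exp (-(b' * (j * d : ℕ)))) *
        (d' * ∑ j ∈ Finset.Icc 1 n, Real.exp (-(b' * (j * d' : ℕ))))) := by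
    intro b'
    have : (d * ∑ j ∈ Finset.Icc 1 n, Real.exp (-(b' * (j * d : ℕ)))) *
        (d' * ∑ j ∈ Finset.Icc 1 n, Real.exp (-(b' * (j * d' : ℕ)))) =
        (d : ℝ) * d' * ∑ j ∈ Finset.Icc 1 n, ∑ j' ∈ Finset.Icc 1 n,
          (Real.exp (-(b' * (j * d : ℕ))) * Real.exp (-(b' * (j' * d' : ℕ)))) := by
      rw [← Finset.sum_mul_sum]; ring
    rw [this]
    have e2 : ∀ x y : ℝ, x * (d * d' * y) = d * d' * (x * y) := fun x y => by ring
    rw [e2, Finset.mul_sum (Finset.Icc 1 n) _ ((1 + η) * (pt n : ℝ))]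
    congr 1
    refine Finset.sum_congr rfl fun j _ => ?_
    rw [Finset.mul_sum]
    refine Finset.sum_congr rfl fun j' _ => ?_
    ring
  have hfin : ∀ b' : ℝ, 0 < b' → (d : ℝ) * d' * ∑ j ∈ Finset.Icc 1 n, ∑ j' ∈ Finset.Icc 1 n,
      ((1 + η) * (Real.exp (-(b' * (j * d : ℕ))) * Real.exp (-(b' * (j' * d' : ℕ)))) * pt n) ≤
      (1 + η) * pt n * (1 / b' * (1 / b')) := by
    intro b' hb'
    rw [hfac]
    have h1 := geom_upper b' hb' d n hd
    have h2 := geom_upper b' hb' d' n hd'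
    have : 0 ≤ ∑ j ∈ Finset.Icc 1 n, Real.exp (-(b' * (j * d' : ℕ))) :=
      Finset.sum_nonneg fun _ _ => (Real.exp_pos _).le
    gcongr
  rw [key]
  by_cases hdd : d = d'
  · subst hdd
    rw [if_pos rfl]
    have hterm : ∀ j j' : ℕ, ∑ μ : Nat.Partition n, I j d μ * I j' d μ ≤
        (1 + η) * (Real.exp (-(b / 2 * (j * d : ℕ))) * Real.exp (-(b / 2 * (j' * d : ℕ)))) * pt n := by
      intro j j'
      have e1 : ∑ μ : Nat.Partition n, I j d μ * I j' d μ =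
        ((Finset.univ.filter (fun μ : Nat.Partition n =>
          Multiset.replicate (max j j') d ≤ μ.parts)).card : ℝ) := by
        rw [Finset.card_filter]
        push_cast
        refine Finset.sum_congr rfl fun μ _ => ?_
        simp only [hI, ← Multiset.le_count_iff_replicate_le, max_le_iff]
        by_cases h1 : j ≤ μ.parts.count d <;> by_cases h2 : j' ≤ μ.parts.count d <;> simp [h1, h2]
      rw [e1]
      refine (card_parts_le h hη _ (fun i hi => by rw [Multiset.eq_of_mem_replicate hi]; exact hd)).trans ?_
      rw [← Real.exp_add]
      gcongr
      rw [← hb, Multiset.sum_replicate, smul_eq_mul]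
      push_cast
      have h1 : (j : ℝ) ≤ max (j : ℝ) j' := le_max_left _ _
      have h2 : (j' : ℝ) ≤ max (j : ℝ) j' := le_max_right _ _
      have h3 : b * d * (j + j') ≤ b * d * (2 * max (j : ℝ) j') := by
        gcongr; linarith
      linarith
    have h1 := hfin (b / 2) (by positivity)
    have e3 : (1 + η) * pt n * (1 / (b / 2) * (1 / (b / 2))) =
        4 * ((1 + η) * (n / (c - η) ^ 2) * pt n) := by
      rw [hbn]; field_simp; norm_num
    rw [← e3]
    refine le_trans ?_ h1
    gcongr with j _ j' _
    exact hterm j j'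
  · rw [if_neg hdd, one_mul]
    have hterm : ∀ j j' : ℕ, ∑ μ : Nat.Partition n, I j d μ * I j' d' μ ≤
        (1 + η) * (Real.exp (-(b * (j * d : ℕ))) * Real.exp (-(b * (j' * d' : ℕ)))) * pt n := by
      intro j j'
      have e1 : ∑ μ : Nat.Partition n, I j d μ * I j' d' μ =
        ((Finset.univ.filter (fun μ : Nat.Partition n =>
          Multiset.replicate j d + Multiset.replicate j' d' ≤ μ.parts)).card : ℝ) := by
        rw [Finset.card_filter]
        push_cast
        refine Finset.sum_congr rfl fun μ _ => ?_
        have hiff : Multiset.replicate j d + Multiset.replicate j' d' ≤ μ.parts ↔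
            Multiset.replicate j d ≤ μ.parts ∧ Multiset.replicate j' d' ≤ μ.parts := by
          constructor
          · intro hh
            exact ⟨(Multiset.le_add_right _ _).trans hh, (Multiset.le_add_left _ _).trans hh⟩
          · rintro ⟨h1, h2⟩
            rw [← Multiset.le_count_iff_replicate_le] at h1 h2
            rw [Multiset.le_iff_count]
            intro a
            rw [Multiset.count_add, Multiset.count_replicate, Multiset.count_replicate]
            split_ifs with h3 h4 h4
            · exact absurd (h3.trans h4.symm) hdd
            · subst h3; simpa using h1
            · subst h4; simpa using h2
            · simp
        simp only [hI, hiff]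
        by_cases h1 : Multiset.replicate j d ≤ μ.parts <;>
          by_cases h2 : Multiset.replicate j' d' ≤ μ.parts <;> simp [h1, h2]
      rw [e1]
      refine (card_parts_le h hη _ (fun i hi => ?_)).trans (le_of_eq ?_)
      · rcases Multiset.mem_add.1 hi with h1 | h1
        · rw [Multiset.eq_of_mem_replicate h1]; exact hd
        · rw [Multiset.eq_of_mem_replicate h1]; exact hd'
      · rw [← Real.exp_add, ← hb, Multiset.sum_add, Multiset.sum_replicate, Multiset.sum_replicate,
          smul_eq_mul, smul_eq_mul]
        congr 3
        push_cast; ring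
    have h1 := hfin b hb0
    have e3 : (1 + η) * pt n * (1 / b * (1 / b)) =
        ((1 + η) * (n / (c - η) ^ 2) * pt n) := by
      rw [hbn]; ring
    rw [← e3]
    refine le_trans ?_ h1
    gcongr with j _ j' _
    exact hterm j j'

lemma first_moment {c η R δ : ℝ} {n : ℕ} (h : LB c η R n) (hc : 0 < c) (hη : 0 < η) (hR : 0 < R)
    (hn : 0 < n)
    (d : ℕ) (hd : 0 < d) (hdd : (d : ℝ) ≤ δ * Real.sqrt n) :
    Real.sqrt n / ((c + η) * (1 + η)) * (1 - (c + η) * δ - Real.exp (-((c + η) * R))) * pt n ≤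
      ∑ μ : Nat.Partition n, ((d : ℝ) * μ.parts.count d) := by
  have hnr : (0 : ℝ) < n := by exact_mod_cast hn
  have hsn := Real.sqrt_pos.2 hnr
  have hdr : (0 : ℝ) < d := by exact_mod_cast hd
  set b := (c + η) / Real.sqrt n with hb
  have hb0 : 0 < b := by positivity
  set J := ⌊R * Real.sqrt n / d⌋₊ with hJ
  have hJ1 : (J : ℝ) * d ≤ R * Real.sqrt n := by
    have := Nat.floor_le (show 0 ≤ R * Real.sqrt n / d by positivity)
    rwa [le_div_iff₀ hdr] at this
  have hJ2 : R * Real.sqrt n ≤ (J + 1) * d := by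
    have := (Nat.lt_floor_add_one (R * Real.sqrt n / d)).le
    rwa [div_le_iff₀ hdr] at this
  have hjs : ∀ j ∈ Finset.Icc 1 J, ((j * d : ℕ) : ℝ) ≤ R * Real.sqrt n := by
    intro j hj
    refine le_trans ?_ hJ1
    push_cast
    have : (j : ℝ) ≤ J := by
      simp at hj; exact_mod_cast hj.2
    gcongr
  have hJn : J ≤ n := by
    rcases Nat.eq_zero_or_pos J with h0 | h0
    · omega
    · have := (h (J * d) (hjs J (by simp; omega))).1
      nlinarith
  set q := Real.exp (-(b * d)) with hq
  have hq0 : 0 < q := Real.exp_pos _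
  have hq1 : q ≤ 1 := by rw [hq, Real.exp_le_one_iff]; have : 0 < b * d := by positivity
                         linarith
  have h1q : 1 - q ≤ b * d := by
    have := Real.add_one_le_exp (-(b * d)); linarith
  have hS : (1 - q) * ∑ j ∈ Finset.Icc 1 J, q ^ j = q - q ^ (J + 1) := by
    generalize J = J
    induction J with
    | zero => simp
    | succ k ih => rw [Finset.sum_Icc_succ_top (by omega), mul_add, ih]; ring
  set S := ∑ j ∈ Finset.Icc 1 J, q ^ j with hSd
  have hS0 : 0 ≤ S := Finset.sum_nonneg fun _ _ => by positivity
  have hqJ : q ^ (J + 1) ≤ Real.exp (-((c + η) * R)) := by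
    rw [hq, ← Real.exp_nat_mul, Real.exp_le_exp]
    have e : b * (R * Real.sqrt n) = (c + η) * R := by rw [hb]; field_simp
    have := mul_le_mul_of_nonneg_left hJ2 hb0.le
    push_cast
    linarith
  have hqd : 1 - (c + η) * δ ≤ q := by
    have : b * d ≤ b * (δ * Real.sqrt n) := by gcongr
    have e : b * (δ * Real.sqrt n) = (c + η) * δ := by rw [hb]; field_simp
    linarith
  have hdS : Real.sqrt n / (c + η) * (1 - (c + η) * δ - Real.exp (-((c + η) * R))) ≤ d * S := by
    have h1 : (1 - q) * S ≤ b * d * S := by gcongr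
    have h2 : 1 - (c + η) * δ - Real.exp (-((c + η) * R)) ≤ b * (d * S) := by linarith
    have e : d * S = Real.sqrt n / (c + η) * (b * (d * S)) := by
      rw [hb]; field_simp
    rw [e]
    gcongr
  have hcount : ∑ μ : Nat.Partition n, ((d : ℝ) * μ.parts.count d) ≥
      d * ∑ j ∈ Finset.Icc 1 J, (pt (n - j * d) : ℝ) := by
    rw [← Finset.mul_sum]
    gcongr
    simp_rw [count_eq_sum _ d hd]
    push_cast
    rw [Finset.sum_comm]
    refine le_trans (le_of_eq ?_) (Finset.sum_le_sum_of_subset_of_nonneg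
      (Finset.Icc_subset_Icc_right hJn) ?_)
    · refine Finset.sum_congr rfl fun j hj => ?_
      have h1 := (h (j * d) (hjs j hj)).1
      have h2 := card_parts_ge n (Multiset.replicate j d)
        (fun i hi => by rw [Multiset.eq_of_mem_replicate hi]; exact hd) (by simpa using h1)
      rw [Multiset.sum_replicate, smul_eq_mul] at h2
      rw [← h2, Finset.card_filter]
      push_cast; rfl
    · intro j _ _
      exact Finset.sum_nonneg fun _ _ => by split_ifs <;> norm_num
  refine le_trans ?_ hcount
  have hpt : S * (pt n : ℝ) ≤ (1 + η) * ∑ j ∈ Finset.Icc 1 J, (pt (n - j * d) : ℝ) := by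
    rw [hSd, Finset.sum_mul, Finset.mul_sum]
    refine Finset.sum_le_sum fun j hj => ?_
    have h1 := (h (j * d) (hjs j hj)).2
    refine le_trans (le_of_eq ?_) h1
    congr 1
    rw [hq, ← Real.exp_nat_mul, hb]
    congr 1
    push_cast; ring
  have h3 : d * (S * (pt n : ℝ)) ≤ d * ((1 + η) * ∑ j ∈ Finset.Icc 1 J, (pt (n - j * d) : ℝ)) := by
    gcongr
  have h4 : Real.sqrt n / (c + η) * (1 - (c + η) * δ - Real.exp (-((c + η) * R))) * pt n ≤
      d * S * pt n := by gcongr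
  have e5 : Real.sqrt n / ((c + η) * (1 + η)) * (1 - (c + η) * δ - Real.exp (-((c + η) * R))) * pt n
      = (Real.sqrt n / (c + η) * (1 - (c + η) * δ - Real.exp (-((c + η) * R))) * pt n) / (1 + η) := by
    field_simp
  rw [e5, div_le_iff₀ (by positivity)]
  linarith

set_option maxHeartbeats 1000000 in
lemma conc (c : ℝ) (hc : 0 < c) (hU : ∀ η : ℝ, 0 < η → η < c → ∀ᶠ n : ℕ in atTop, UB c η n)
    (hL : ∀ η R : ℝ, 0 < η → 0 < R → ∀ᶠ n : ℕ in atTop, LB c η R n)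
    (ε θ : ℝ) (hε : 0 < ε) (hθ : 0 < θ) :
    ∃ δ : ℝ, 0 < δ ∧ ∃ K0 : ℕ, ∀ᶠ n : ℕ in atTop, ∀ Ds : Finset ℕ,
      (∀ d ∈ Ds, 0 < d ∧ (d : ℝ) ≤ δ * Real.sqrt n) → K0 ≤ Ds.card →
      ((Finset.univ.filter (fun μ : Nat.Partition n =>
        (∑ d ∈ Ds, (d : ℝ) * μ.parts.count d) ≤ (1 - θ) * (Ds.card * Real.sqrt n / c))).card : ℝ)
        ≤ ε * pt n := by
  set e := min (ε * θ ^ 2 / 3) 1 with he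
  have he0 : 0 < e := lt_min (by positivity) one_pos
  have he1 : 3 * e ≤ ε * θ ^ 2 := by
    have := min_le_left (ε * θ ^ 2 / 3) 1
    rw [← he] at this; linarith
  have hηex : ∃ η : ℝ, 0 < η ∧ η < c ∧ 1 - e < c / ((c + η) * (1 + η)) * (1 - 2 * e / 3) ∧
      (1 + η) ^ 2 * (c / (c - η)) ^ 2 < 1 + e := by
    have t1 : ContinuousAt (fun η : ℝ => c / ((c + η) * (1 + η)) * (1 - 2 * e / 3)) 0 := by
      have : (c + 0) * (1 + 0) ≠ 0 := by simp; exact hc.ne'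
      fun_prop (disch := assumption)
    have t2 : ContinuousAt (fun η : ℝ => (1 + η) ^ 2 * (c / (c - η)) ^ 2) 0 := by
      have : c - 0 ≠ 0 := by simp; exact hc.ne'
      fun_prop (disch := assumption)
    have v1 : 1 - e < c / ((c + 0) * (1 + 0)) * (1 - 2 * e / 3) := by
      rw [add_zero, add_zero, mul_one, div_self hc.ne']; linarith
    have v2 : (1 + 0) ^ 2 * (c / (c - 0)) ^ 2 < 1 + e := by
      rw [add_zero, sub_zero, div_self hc.ne']; linarith
    have e1 := t1.eventually (lt_mem_nhds v1)
    have e2 := t2.eventually (gt_mem_nhds v2)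
    have e3 : ∀ᶠ x : ℝ in nhds 0, x < c := eventually_lt_nhds hc
    have := ((e1.and e2).and e3).filter_mono (nhdsWithin_le_nhds (s := Set.Ioi 0))
    obtain ⟨η, ⟨⟨h1, h2⟩, h3⟩, h4⟩ := (this.and self_mem_nhdsWithin).exists
    exact ⟨η, h4, h3, h1, h2⟩
  obtain ⟨η, hη, hηc, hη1, hη2⟩ := hηex
  set δ := e / (3 * (c + η)) with hδ
  set R := 3 / (e * (c + η)) with hR
  have hδ0 : 0 < δ := by positivity
  have hR0 : 0 < R := by positivity
  have hδe : (c + η) * δ = e / 3 := by rw [hδ]; field_simp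
  have hRe : Real.exp (-((c + η) * R)) ≤ e / 3 := by
    have h1 : (c + η) * R = 3 / e := by rw [hR]; field_simp
    rw [h1, Real.exp_neg]
    have h2 := Real.add_one_le_exp (3 / e)
    have h3 : 0 < 3 / e := by positivity
    have h4 : (Real.exp (3 / e))⁻¹ ≤ (3 / e)⁻¹ := by
      apply inv_anti₀ h3; linarith
    rwa [inv_div] at h4
  obtain ⟨K0, hK0⟩ := exists_nat_ge (3 / η)
  refine ⟨δ, hδ0, max K0 1, ?_⟩
  filter_upwards [hU η hη hηc, hL η R hη hR0, eventually_gt_atTop 0] with n hub hlb hn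
  intro Ds hDs hcard
  have hnr : (0 : ℝ) < n := by exact_mod_cast hn
  have hsn := Real.sqrt_pos.2 hnr
  have hsq := Real.sq_sqrt hnr.le
  set s := Real.sqrt n with hs
  set K := Ds.card with hK
  have hK1 : (1 : ℝ) ≤ K := by exact_mod_cast (le_max_right K0 1).trans hcard
  have hKη : 3 ≤ K * η := by
    have : (K0 : ℝ) ≤ K := by exact_mod_cast (le_max_left K0 1).trans hcard
    have h1 : 3 / η ≤ K := hK0.trans this
    rwa [div_le_iff₀ hη] at h1
  have hp : (0 : ℝ) < pt n := Nat.cast_pos.2 (pt_pos n)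
  set p : ℝ := (pt n : ℝ) with hpd
  set a := (K : ℝ) * s / c with ha
  have ha0 : 0 < a := by positivity
  set Y : Nat.Partition n → ℝ := fun μ => ∑ d ∈ Ds, (d : ℝ) * μ.parts.count d with hY
  have hfirst : a * (1 - e) * p ≤ ∑ μ, Y μ := by
    simp only [hY]
    rw [Finset.sum_comm]
    have h1 : ∀ d ∈ Ds, s / c * (1 - e) * p ≤ ∑ μ : Nat.Partition n, (d : ℝ) * μ.parts.count d := by
      intro d hd
      refine le_trans ?_ (first_moment hlb hc hη hR0 hn d (hDs d hd).1 (hDs d hd).2)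
      rw [hδe]
      have h2 : s / c * (1 - e) ≤ s / c * (c / ((c + η) * (1 + η)) * (1 - 2 * e / 3)) := by
        gcongr
      have h3 : s / c * (c / ((c + η) * (1 + η)) * (1 - 2 * e / 3)) =
        s / ((c + η) * (1 + η)) * (1 - 2 * e / 3) := by field_simp
      have h4 : s / ((c + η) * (1 + η)) * (1 - 2 * e / 3) ≤
        s / ((c + η) * (1 + η)) * (1 - e / 3 - Real.exp (-((c + η) * R))) := by
        refine mul_le_mul_of_nonneg_left ?_ (by positivity)
        linarith
      have h5 := (h2.trans h3.le).trans h4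
      exact mul_le_mul_of_nonneg_right h5 hp.le
    calc a * (1 - e) * p = ∑ d ∈ Ds, s / c * (1 - e) * p := by
          rw [Finset.sum_const, nsmul_eq_mul, ha]; ring
      _ ≤ _ := Finset.sum_le_sum h1
  have hsecond : ∑ μ, Y μ ^ 2 ≤ a ^ 2 * (1 + e) * p := by
    set B := (1 + η) * (n / (c - η) ^ 2) * p with hB
    have hcη : 0 < c - η := by linarith
    have hB0 : 0 < B := by positivity
    have h1 : ∑ μ, Y μ ^ 2 = ∑ d ∈ Ds, ∑ d' ∈ Ds, ∑ μ : Nat.Partition n,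
        ((d : ℝ) * μ.parts.count d) * (d' * μ.parts.count d') := by
      have hμ : ∀ μ, Y μ ^ 2 = ∑ d ∈ Ds, ∑ d' ∈ Ds,
          ((d : ℝ) * μ.parts.count d) * (d' * μ.parts.count d') := by
        intro μ
        rw [← Finset.sum_mul_sum, sq]
      rw [Finset.sum_congr rfl fun μ _ => hμ μ, Finset.sum_comm]
      exact Finset.sum_congr rfl fun d _ => Finset.sum_comm
    have h2 : ∑ μ, Y μ ^ 2 ≤ ∑ d ∈ Ds, ∑ d' ∈ Ds, (if d = d' then 4 else 1) * B := by
      rw [h1]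
      exact Finset.sum_le_sum fun d hd => Finset.sum_le_sum fun d' hd' =>
        second_moment hub hη hηc hn d d' (hDs d hd).1 (hDs d' hd').1
    have h3 : ∑ d ∈ Ds, ∑ d' ∈ Ds, (if d = d' then (4 : ℝ) else 1) * B = (K ^ 2 + 3 * K) * B := by
      have h4 : ∀ d ∈ Ds, ∑ d' ∈ Ds, (if d = d' then (4 : ℝ) else 1) * B = (K + 3) * B := by
        intro d hd
        rw [← Finset.sum_mul]
        congr 1
        have : ∀ d' ∈ Ds, (if d = d' then (4 : ℝ) else 1) = 1 + if d = d' then 3 else 0 := by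
          intro d' _; split_ifs <;> norm_num
        rw [Finset.sum_congr rfl this, Finset.sum_add_distrib, Finset.sum_ite_eq, if_pos hd]
        simp [hK]
      rw [Finset.sum_congr rfl h4, Finset.sum_const, nsmul_eq_mul]; ring
    have h5 : (K ^ 2 + 3 * K : ℝ) ≤ K ^ 2 * (1 + η) := by nlinarith
    have h6 : (K ^ 2 * (1 + η) : ℝ) * B = a ^ 2 * ((1 + η) ^ 2 * (c / (c - η)) ^ 2) * p := by
      rw [hB, ha, ← hsq]; field_simp
    calc ∑ μ, Y μ ^ 2 ≤ (K ^ 2 + 3 * K) * B := h2.trans h3.le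
      _ ≤ (K ^ 2 * (1 + η)) * B := by gcongr
      _ = a ^ 2 * ((1 + η) ^ 2 * (c / (c - η)) ^ 2) * p := h6
      _ ≤ _ := by gcongr
  have hvar : ∑ μ, (Y μ - a) ^ 2 ≤ 3 * e * a ^ 2 * p := by
    have h1 : ∑ μ, (Y μ - a) ^ 2 = ∑ μ, Y μ ^ 2 - 2 * a * ∑ μ, Y μ + a ^ 2 * p := by
      have : ∀ μ, (Y μ - a) ^ 2 = Y μ ^ 2 - 2 * a * Y μ + a ^ 2 := fun μ => by ring
      rw [Finset.sum_congr rfl fun μ _ => this μ, Finset.sum_add_distrib, Finset.sum_sub_distrib,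
        ← Finset.mul_sum]
      simp [hpd, pt, Finset.card_univ, mul_comm]
    rw [h1]
    have h2 : 2 * a * (a * (1 - e) * p) ≤ 2 * a * ∑ μ, Y μ := by gcongr
    linarith
  set bad := Finset.univ.filter (fun μ : Nat.Partition n => Y μ ≤ (1 - θ) * a) with hbad
  have hb : (bad.card : ℝ) * (θ ^ 2 * a ^ 2) ≤ ∑ μ, (Y μ - a) ^ 2 := by
    calc (bad.card : ℝ) * (θ ^ 2 * a ^ 2) = ∑ μ ∈ bad, (θ ^ 2 * a ^ 2) := by
          rw [Finset.sum_const, nsmul_eq_mul]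
      _ ≤ ∑ μ ∈ bad, (Y μ - a) ^ 2 := by
          refine Finset.sum_le_sum fun μ hμ => ?_
          have h1 : Y μ ≤ (1 - θ) * a := (Finset.mem_filter.1 hμ).2
          have h2 : θ * a ≤ a - Y μ := by linarith
          have h3 : 0 ≤ θ * a := by positivity
          nlinarith
      _ ≤ ∑ μ, (Y μ - a) ^ 2 := Finset.sum_le_sum_of_subset_of_nonneg (Finset.subset_univ _)
          fun _ _ _ => sq_nonneg _
  have hlast : (bad.card : ℝ) * (θ ^ 2 * a ^ 2) ≤ (ε * p) * (θ ^ 2 * a ^ 2) := by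
    refine (hb.trans hvar).trans ?_
    have : 3 * e * (a ^ 2 * p) ≤ ε * θ ^ 2 * (a ^ 2 * p) := by gcongr
    linarith
  exact le_of_mul_le_mul_right hlast (by positivity)

/-- The beta numbers of a partition. -/
def bt {n : ℕ} (lam : Nat.Partition n) (i : Fin n) : ℕ :=
  ((lam.parts.sort (· ≤ ·)).reverse.getD i 0) + (n - 1 - (i : ℕ))

/-- The Vandermonde factor. -/
noncomputable def vD (n : ℕ) : MvPolynomial (Fin n) ℤ :=
  ∏ i : Fin n, ∏ j ∈ Finset.univ.filter (fun j : Fin n => (i : ℕ) < (j : ℕ)),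
        (MvPolynomial.X i - MvPolynomial.X j)

/-- Power sums. -/
noncomputable def pP (n m : ℕ) : MvPolynomial (Fin n) ℤ := ∑ i : Fin n, MvPolynomial.X i ^ m

lemma vD_eq (n : ℕ) : vD n =
    (Matrix.vandermonde (fun i : Fin n => -(MvPolynomial.X i : MvPolynomial (Fin n) ℤ))).det := by
  rw [Matrix.det_vandermonde, vD]
  refine Finset.prod_congr rfl fun i _ => ?_
  have : Finset.univ.filter (fun j : Fin n => (i : ℕ) < (j : ℕ)) = Finset.Ioi i := by
    ext j; simp
  rw [this]
  refine Finset.prod_congr rfl fun j _ => ?_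
  ring

lemma rename_vD (n : ℕ) (σ : Equiv.Perm (Fin n)) :
    MvPolynomial.rename σ (vD n) = ((Equiv.Perm.sign σ : ℤ) : MvPolynomial (Fin n) ℤ) * vD n := by
  rw [vD_eq, AlgHom.map_det]
  have h : (MvPolynomial.rename σ : MvPolynomial (Fin n) ℤ →ₐ[ℤ] _).mapMatrix
      (Matrix.vandermonde (fun i : Fin n => -(MvPolynomial.X i : MvPolynomial (Fin n) ℤ))) =
      (Matrix.vandermonde (fun i : Fin n => -(MvPolynomial.X i : MvPolynomial (Fin n) ℤ))).submatrix
        σ id := by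
    ext1 i j
    simp [Matrix.vandermonde_apply]
  rw [h, Matrix.det_permute]

lemma rename_pP (n m : ℕ) (σ : Equiv.Perm (Fin n)) :
    MvPolynomial.rename σ (pP n m) = pP n m := by
  simp only [pP, map_sum, map_pow, MvPolynomial.rename_X]
  exact Equiv.sum_comp σ (fun i => (MvPolynomial.X i : MvPolynomial (Fin n) ℤ) ^ m)

lemma coeff_antisymm {n : ℕ} (G : MvPolynomial (Fin n) ℤ)
    (hG : ∀ σ : Equiv.Perm (Fin n), MvPolynomial.rename σ G = G) (β : Fin n →₀ ℕ)
    (hβ : MvPolynomial.coeff β (vD n * G) ≠ 0) : Function.Injective β := by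
  intro a b hab
  by_contra hne
  apply hβ
  have h1 := MvPolynomial.coeff_rename_mapDomain (Equiv.swap a b) (Equiv.swap a b).injective
    (vD n * G) β
  have h2 : Finsupp.mapDomain (Equiv.swap a b) β = β := by
    rw [← Finsupp.equivMapDomain_eq_mapDomain]
    ext i
    rw [Finsupp.equivMapDomain_apply, Equiv.symm_swap, Equiv.swap_apply_def]
    split_ifs with h3 h4
    · rw [h3, hab]
    · rw [h4, hab]
    · rfl
  rw [h2, map_mul, hG, rename_vD, Equiv.Perm.sign_swap hne] at h1
  simp only [Units.val_neg, Units.val_one, Int.cast_neg, Int.cast_one, neg_mul, one_mul,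
    MvPolynomial.coeff_neg] at h1
  omega

lemma pP_mod (n m k : ℕ) :
    MvPolynomial.map (Int.castRingHom (ZMod 2)) (pP n (2 ^ k * m)) =
      (MvPolynomial.map (Int.castRingHom (ZMod 2)) (pP n m)) ^ 2 ^ k := by
  have : Fact (Nat.Prime 2) := ⟨Nat.prime_two⟩
  simp only [pP, map_sum, map_pow, MvPolynomial.map_X]
  rw [sum_pow_char_pow]
  refine Finset.sum_congr rfl fun i _ => ?_
  rw [← pow_mul, mul_comm]

lemma prod_mod (n m K : ℕ) (hm : 0 < m) (s : Multiset ℕ) :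
    ∃ G : MvPolynomial (Fin n) ℤ, (∀ σ : Equiv.Perm (Fin n), MvPolynomial.rename σ G = G) ∧
      MvPolynomial.map (Int.castRingHom (ZMod 2)) (s.map (pP n)).prod =
        (MvPolynomial.map (Int.castRingHom (ZMod 2)) (pP n m)) ^
          (∑ k ∈ Finset.range K, 2 ^ k * s.count (2 ^ k * m)) *
        MvPolynomial.map (Int.castRingHom (ZMod 2)) G := by
  induction s using Multiset.induction_on with
  | empty => exact ⟨1, fun σ => map_one _, by simp⟩
  | cons a s ih =>
    obtain ⟨G, hG, h⟩ := ih
    by_cases ha : ∃ k ∈ Finset.range K, a = 2 ^ k * m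
    · obtain ⟨k, hk, rfl⟩ := ha
      refine ⟨G, hG, ?_⟩
      have hc : ∑ k' ∈ Finset.range K, 2 ^ k' * ((2 ^ k * m) ::ₘ s).count (2 ^ k' * m) =
          ∑ k' ∈ Finset.range K, 2 ^ k' * s.count (2 ^ k' * m) + 2 ^ k := by
        simp only [Multiset.count_cons, mul_add, Finset.sum_add_distrib]
        congr 1
        rw [Finset.sum_eq_single_of_mem k hk]
        · simp
        · intro b _ hb
          rw [if_neg, mul_zero]
          intro he
          exact hb (Nat.pow_right_injective le_rfl (Nat.eq_of_mul_eq_mul_right hm he))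
      rw [hc, Multiset.map_cons, Multiset.prod_cons, map_mul, h, pP_mod, pow_add]
      ring
    · refine ⟨pP n a * G, fun σ => by rw [map_mul, rename_pP, hG], ?_⟩
      have hc : ∑ k' ∈ Finset.range K, 2 ^ k' * (a ::ₘ s).count (2 ^ k' * m) =
          ∑ k' ∈ Finset.range K, 2 ^ k' * s.count (2 ^ k' * m) := by
        refine Finset.sum_congr rfl fun k hk => ?_
        rw [Multiset.count_cons_of_ne]
        intro he
        exact ha ⟨k, hk, he.symm⟩
      rw [hc, Multiset.map_cons, Multiset.prod_cons, map_mul, h, map_mul]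
      ring

lemma odd_imp {n : ℕ} (m K j : ℕ) (hm : 0 < m) (lam mu : Nat.Partition n)
    (hA : 2 ^ j ≤ ∑ k ∈ Finset.range K, 2 ^ k * mu.parts.count (2 ^ k * m))
    (hodd : Odd (charSn n lam mu)) :
    ∃ i : Fin n, 2 ^ j * m ≤ bt lam i ∧ ∀ i', bt lam i' ≠ bt lam i - 2 ^ j * m := by
  set α : Fin n →₀ ℕ := Finsupp.equivFunOnFinite.symm (bt lam) with hα
  have hch : charSn n lam mu = MvPolynomial.coeff α (vD n * (mu.parts.map (pP n)).prod) := rfl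
  obtain ⟨G, hG, h⟩ := prod_mod n m K hm mu.parts
  set A := ∑ k ∈ Finset.range K, 2 ^ k * mu.parts.count (2 ^ k * m) with hAd
  set G' := (pP n m) ^ (A - 2 ^ j) * G with hG'
  have hG's : ∀ σ : Equiv.Perm (Fin n), MvPolynomial.rename σ G' = G' := by
    intro σ
    rw [hG', map_mul, map_pow, rename_pP, hG]
  have h2 : MvPolynomial.map (Int.castRingHom (ZMod 2)) (mu.parts.map (pP n)).prod =
      MvPolynomial.map (Int.castRingHom (ZMod 2)) (pP n (2 ^ j * m) * G') := by
    rw [h, hG', map_mul, map_mul, map_pow, pP_mod, ← mul_assoc, ← pow_add]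
    congr 2
    omega
  have h3 : ((charSn n lam mu : ℤ) : ZMod 2) =
      ((MvPolynomial.coeff α (pP n (2 ^ j * m) * (vD n * G')) : ℤ) : ZMod 2) := by
    have e1 := MvPolynomial.coeff_map (Int.castRingHom (ZMod 2)) (vD n * (mu.parts.map (pP n)).prod) α
    have e2 := MvPolynomial.coeff_map (Int.castRingHom (ZMod 2)) (pP n (2 ^ j * m) * (vD n * G')) α
    rw [eq_intCast] at e1 e2
    rw [hch, ← e1, ← e2, map_mul, h2, ← map_mul]
    congr 2
    ring
  have h4 : MvPolynomial.coeff α (pP n (2 ^ j * m) * (vD n * G')) ≠ 0 := by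
    intro h0
    rw [h0, Int.cast_zero, ZMod.intCast_eq_zero_iff_even] at h3
    exact (Int.not_even_iff_odd.2 hodd) h3
  rw [pP, Finset.sum_mul, MvPolynomial.coeff_sum] at h4
  obtain ⟨i, _, hi⟩ := Finset.exists_ne_zero_of_sum_ne_zero h4
  rw [MvPolynomial.X_pow_eq_monomial, MvPolynomial.coeff_monomial_mul'] at hi
  have hle : Finsupp.single i (2 ^ j * m) ≤ α := by
    by_contra hh; rw [if_neg hh] at hi; exact hi rfl
  rw [if_pos hle, one_mul] at hi
  have hinj := coeff_antisymm G' hG's _ hi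
  have hti : 2 ^ j * m ≤ bt lam i := by
    have := hle i
    simpa [hα] using this
  refine ⟨i, hti, fun i' hi' => ?_⟩
  have ht : 0 < 2 ^ j * m := by positivity
  have hne : i' ≠ i := by
    rintro rfl; omega
  apply hne
  apply hinj
  simp only [Finsupp.coe_tsub, Pi.sub_apply, Finsupp.single_eq_same, hα,
    Finsupp.equivFunOnFinite_symm_apply_apply]
  rw [Finsupp.single_eq_of_ne (by tauto)]
  simpa using hi'

/-- Sets of `N` naturals with sum `M`. -/
def bV (N M : ℕ) : Finset (Finset ℕ) :=
  (Finset.powersetCard N (Finset.range (M + 1))).filter fun X => ∑ x ∈ X, x = M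

lemma mem_bV {N M : ℕ} {X : Finset ℕ} : X ∈ bV N M ↔ X.card = N ∧ ∑ x ∈ X, x = M := by
  simp only [bV, Finset.mem_filter, Finset.mem_powersetCard]
  constructor
  · rintro ⟨⟨_, h1⟩, h2⟩; exact ⟨h1, h2⟩
  · rintro ⟨h1, h2⟩
    refine ⟨⟨fun x hx => ?_, h1⟩, h2⟩
    have := Finset.single_le_sum (f := fun x : ℕ => x) (fun _ _ => Nat.zero_le _) hx
    simp only [Finset.mem_range]
    omega

/-- Removable beads. -/
def remB (t : ℕ) (X : Finset ℕ) : Finset ℕ := X.filter fun x => t ≤ x ∧ x - t ∉ X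

/-- Number of removable beads in all configurations. -/
def bS (N t M : ℕ) : ℕ := ∑ X ∈ bV N M, (remB t X).card

lemma add_le_rem (t : ℕ) (Y : Finset ℕ) :
    (Y.filter fun y => y + t ∉ Y).card ≤ t + (remB t Y).card := by
  have h1 : (Y.filter fun y => y + t ∈ Y).card + (Y.filter fun y => y + t ∉ Y).card = Y.card :=
    Finset.card_filter_add_card_filter_not _
  have h2 : (Y.filter fun y => t ≤ y ∧ y - t ∈ Y).card ≤ (Y.filter fun y => y + t ∈ Y).card := by
    refine Finset.card_le_card_of_injOn (fun y => y - t) ?_ ?_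
    · intro y hy
      simp only [Finset.coe_filter, Set.mem_ofPred_eq] at hy ⊢
      refine ⟨hy.2.2, ?_⟩
      rw [Nat.sub_add_cancel hy.2.1]; exact hy.1
    · intro y hy z hz h
      simp only [Finset.coe_filter, Set.mem_ofPred_eq] at hy hz h
      omega
  have h3 : Y ⊆ (Finset.range t ∪ remB t Y) ∪ (Y.filter fun y => t ≤ y ∧ y - t ∈ Y) := by
    intro y hy
    simp only [Finset.mem_union, Finset.mem_range, remB, Finset.mem_filter]
    by_cases h4 : y < t
    · exact Or.inl (Or.inl h4)
    · by_cases h5 : y - t ∈ Y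
      · exact Or.inr ⟨hy, by omega, h5⟩
      · exact Or.inl (Or.inr ⟨hy, by omega, h5⟩)
  have h4 := Finset.card_le_card h3
  have h5 := Finset.card_union_le (Finset.range t ∪ remB t Y) (Y.filter fun y => t ≤ y ∧ y - t ∈ Y)
  have h6 := Finset.card_union_le (Finset.range t) (remB t Y)
  rw [Finset.card_range] at h6
  omega

lemma bS_rec (N t M : ℕ) (ht : 0 < t) (htM : t ≤ M) :
    bS N t M ≤ t * (bV N (M - t)).card + bS N t (M - t) := by
  have h1 : bS N t M ≤ ∑ Y ∈ bV N (M - t), (Y.filter fun y => y + t ∉ Y).card := by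
    rw [bS, ← Finset.card_sigma, ← Finset.card_sigma]
    refine Finset.card_le_card_of_injOn
      (fun p => ⟨insert (p.2 - t) (p.1.erase p.2), p.2 - t⟩) ?_ ?_
    · rintro ⟨X, x⟩ hp
      simp only [Finset.coe_sigma, Set.mem_sigma_iff, Finset.mem_coe, remB, Finset.mem_filter,
        mem_bV] at hp ⊢
      obtain ⟨⟨hc, hs⟩, hx, htx, hnx⟩ := hp
      have hne : x - t ∉ X.erase x := fun h => hnx (Finset.mem_of_mem_erase h)
      refine ⟨⟨?_, ?_⟩, Finset.mem_insert_self _ _, ?_⟩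
      · rw [Finset.card_insert_of_notMem hne, Finset.card_erase_of_mem hx]
        have := Finset.card_pos.2 ⟨x, hx⟩
        omega
      · rw [Finset.sum_insert hne]
        have := Finset.add_sum_erase X (fun x => x) hx
        omega
      · rw [Nat.sub_add_cancel htx]
        simp only [Finset.mem_insert, Finset.mem_erase]
        omega
    · rintro ⟨X, x⟩ hp ⟨X', x'⟩ hp' h
      simp only [Finset.coe_sigma, Set.mem_sigma_iff, Finset.mem_coe, remB, Finset.mem_filter,
        mem_bV] at hp hp'
      obtain ⟨_, hx, htx, hnx⟩ := hp
      obtain ⟨_, hx', htx', hnx'⟩ := hp'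
      simp only [Sigma.mk.injEq, heq_eq_eq] at h
      obtain ⟨h1, h2⟩ := h
      have hxx : x = x' := by omega
      subst hxx
      have hne : x - t ∉ X.erase x := fun h => hnx (Finset.mem_of_mem_erase h)
      have hne' : x - t ∉ X'.erase x := fun h => hnx' (Finset.mem_of_mem_erase h)
      have h3 : X.erase x = X'.erase x := by
        rw [← Finset.erase_insert hne, h1, Finset.erase_insert hne']
      have h4 : X = X' := by
        rw [← Finset.insert_erase hx, h3, Finset.insert_erase hx']
      subst h4; rfl
  refine h1.trans ?_
  rw [bS, mul_comm, ← smul_eq_mul, ← Finset.sum_const, ← Finset.sum_add_distrib]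
  exact Finset.sum_le_sum fun Y _ => add_le_rem t Y

lemma bS_small (N t M : ℕ) (htM : M < t) : bS N t M = 0 := by
  rw [bS]
  refine Finset.sum_eq_zero fun X hX => ?_
  rw [Finset.card_eq_zero, remB, Finset.filter_eq_empty_iff]
  intro x hx hh
  have := Finset.single_le_sum (f := fun x : ℕ => x) (fun _ _ => Nat.zero_le _) hx
  simp only [(mem_bV.1 hX).2] at this
  omega

lemma le_of_strictMono {N : ℕ} (e : Fin N → ℕ) (he : StrictMono e) (i : Fin N) : (i : ℕ) ≤ e i := by
  obtain ⟨k, hk⟩ := i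
  induction k with
  | zero => exact Nat.zero_le _
  | succ k ih =>
    have h1 := ih (by omega)
    have h2 : e ⟨k, by omega⟩ < e ⟨k + 1, hk⟩ := he (by simp [Fin.lt_def])
    simp only at h1 ⊢
    omega

lemma bV_sum {N M : ℕ} {X : Finset ℕ} (hX : X ∈ bV N M) :
    ∑ i : Fin N, X.orderEmbOfFin (mem_bV.1 hX).1 i = M := by
  have h := (mem_bV.1 hX).2
  rw [← Finset.image_orderEmbOfFin_univ X (mem_bV.1 hX).1, Finset.sum_image] at h
  · exact h
  · intro a _ b _ hab
    exact (X.orderEmbOfFin (mem_bV.1 hX).1).injective hab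

lemma bV_small (N M : ℕ) (h : M < ∑ i ∈ Finset.range N, i) : bV N M = ∅ := by
  rw [Finset.eq_empty_iff_forall_notMem]
  intro X hX
  have h1 := bV_sum hX
  have h2 : ∑ i : Fin N, (i : ℕ) ≤ ∑ i : Fin N, X.orderEmbOfFin (mem_bV.1 hX).1 i :=
    Finset.sum_le_sum fun i _ => le_of_strictMono _ (X.orderEmbOfFin (mem_bV.1 hX).1).strictMono i
  rw [h1, Fin.sum_univ_eq_sum_range (fun i => i)] at h2
  omega

lemma multiset_eq_of_filter (s s' : Multiset ℕ) (hc : s.card = s'.card)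
    (h : s.filter (· ≠ 0) = s'.filter (· ≠ 0)) : s = s' := by
  have key : ∀ u : Multiset ℕ, u = u.filter (· ≠ 0) +
      Multiset.replicate (u.card - (u.filter (· ≠ 0)).card) 0 := by
    intro u
    have h1 := Multiset.filter_add_not (fun x => x ≠ 0) u
    have h2 : u.filter (fun x => ¬ x ≠ 0) =
        Multiset.replicate (u.filter (fun x => ¬ x ≠ 0)).card 0 := by
      rw [Multiset.eq_replicate]
      refine ⟨rfl, fun b hb => ?_⟩
      have := (Multiset.mem_filter.1 hb).2
      omega
    have h3 := congrArg Multiset.card h1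
    rw [Multiset.card_add] at h3
    conv_lhs => rw [← h1, h2]
    congr 2
    omega
  rw [key s, key s', h, hc]

lemma monotone_eq_of_map {N : ℕ} (f g : Fin N → ℕ) (hf : Monotone f) (hg : Monotone g)
    (h : (Finset.univ : Finset (Fin N)).val.map f = (Finset.univ : Finset (Fin N)).val.map g) :
    f = g := by
  rw [Fin.univ_val_map, Fin.univ_val_map, Multiset.coe_eq_coe] at h
  exact List.ofFn_injective (h.eq_of_sortedLE hf.sortedLE_ofFn hg.sortedLE_ofFn)

lemma bV_card_le (N m : ℕ) : (bV N (m + ∑ i ∈ Finset.range N, i)).card ≤ pt m := by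
  set M := m + ∑ i ∈ Finset.range N, i with hM
  have hle : ∀ X (hX : X ∈ bV N M) (i : Fin N), (i : ℕ) ≤ X.orderEmbOfFin (mem_bV.1 hX).1 i :=
    fun X hX i => le_of_strictMono _ (X.orderEmbOfFin (mem_bV.1 hX).1).strictMono i
  have hsum : ∀ X (hX : X ∈ bV N M), ((Finset.univ : Finset (Fin N)).val.map
      (fun i => X.orderEmbOfFin (mem_bV.1 hX).1 i - (i : ℕ))).sum = m := by
    intro X hX
    change ∑ i : Fin N, (X.orderEmbOfFin (mem_bV.1 hX).1 i - (i : ℕ)) = m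
    have h1 := bV_sum hX
    have h2 : ∑ i : Fin N, (X.orderEmbOfFin (mem_bV.1 hX).1 i - (i : ℕ)) + ∑ i : Fin N, (i : ℕ) =
        ∑ i : Fin N, X.orderEmbOfFin (mem_bV.1 hX).1 i := by
      rw [← Finset.sum_add_distrib]
      exact Finset.sum_congr rfl fun i _ => Nat.sub_add_cancel (hle X hX i)
    rw [h1, Fin.sum_univ_eq_sum_range (fun i => i)] at h2
    omega
  have hmono : ∀ X (hX : X ∈ bV N M),
      Monotone (fun i : Fin N => X.orderEmbOfFin (mem_bV.1 hX).1 i - (i : ℕ)) := by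
    intro X hX
    have hs := (X.orderEmbOfFin (mem_bV.1 hX).1).strictMono
    set e := X.orderEmbOfFin (mem_bV.1 hX).1 with he
    have hstep : ∀ (k a : ℕ) (ha : a + k < N), e ⟨a, by omega⟩ + k ≤ e ⟨a + k, ha⟩ := by
      intro k
      induction k with
      | zero => intro a ha; exact le_rfl
      | succ k ih =>
        intro a ha
        have h1 := ih a (by omega)
        have h2 : e ⟨a + k, by omega⟩ < e ⟨a + (k + 1), ha⟩ := hs (by simp [Fin.lt_def])
        omega
    intro i j hij
    have hij' : (i : ℕ) ≤ j := hij
    have h1 := hstep (j - i) i (by omega)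
    have h2 : (⟨(i : ℕ) + ((j : ℕ) - i), by omega⟩ : Fin N) = j := by
      apply Fin.ext; simp only; omega
    rw [h2] at h1
    simp only
    have h3 : (⟨(i : ℕ), by omega⟩ : Fin N) = i := rfl
    rw [h3] at h1
    omega
  rw [pt, ← Finset.card_univ, ← Finset.card_attach]
  refine Finset.card_le_card_of_injOn
    (fun X => Nat.Partition.ofSums m _ (hsum X.1 X.2)) (fun _ _ => Finset.mem_coe.2 (Finset.mem_univ _)) ?_
  rintro ⟨X, hX⟩ _ ⟨Y, hY⟩ _ h
  have h1 := congrArg Nat.Partition.parts h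
  simp only [Nat.Partition.ofSums] at h1
  have h2 := multiset_eq_of_filter _ _ (by simp) h1
  have h3 := monotone_eq_of_map _ _ (hmono X hX) (hmono Y hY) h2
  have h4 : X = Y := by
    rw [← Finset.image_orderEmbOfFin_univ X (mem_bV.1 hX).1,
      ← Finset.image_orderEmbOfFin_univ Y (mem_bV.1 hY).1]
    congr 1
    ext i
    have h5 := congrFun h3 i
    have h6 := hle X hX i
    have h7 := hle Y hY i
    omega
  subst h4
  rfl

lemma bS_le (N t : ℕ) (ht : 0 < t) (m : ℕ) : bS N t (m + ∑ i ∈ Finset.range N, i) ≤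
    t * ∑ k ∈ Finset.Icc 1 (m / t), pt (m - k * t) := by
  induction m using Nat.strong_induction_on with
  | _ m ih =>
    set B := ∑ i ∈ Finset.range N, i with hB
    by_cases hmt : t ≤ m
    · have h1 := bS_rec N t (m + B) ht (by omega)
      have h2 := ih (m - t) (by omega)
      have h3 := bV_card_le N (m - t)
      rw [← hB] at h3
      have h4 : m + B - t = m - t + B := by omega
      rw [h4] at h1
      have h5 : m / t = (m - t) / t + 1 := by
        rw [← Nat.add_div_right _ ht, Nat.sub_add_cancel hmt]
      have h6 : ∑ k ∈ Finset.Icc 1 (m / t), pt (m - k * t) =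
          pt (m - t) + ∑ k ∈ Finset.Icc 1 ((m - t) / t), pt (m - t - k * t) := by
        rw [h5]
        rw [← Finset.add_sum_Ioc_eq_sum_Icc (Nat.le_add_left 1 _), one_mul]
        congr 1
        refine (Finset.sum_bij (fun k _ => k + 1) ?_ ?_ ?_ ?_).symm
        · intro k hk; simp at hk ⊢; omega
        · intro a _ b _ h; omega
        · intro k hk
          simp only [Finset.mem_Ioc] at hk
          exact ⟨k - 1, by simp only [Finset.mem_Icc]; omega, by omega⟩
        · intro k hk
          congr 1
          rw [add_mul, one_mul]; omega
      rw [h6, mul_add]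
      have h7 : t * (bV N (m - t + B)).card ≤ t * pt (m - t) := Nat.mul_le_mul_left _ h3
      omega
    · have h0 : bS N t (m + B) = 0 := by
        by_cases h1 : t ≤ m + B
        · have h2 := bS_rec N t (m + B) ht h1
          have h3 := bV_small N (m + B - t) (by omega)
          have h4 : bS N t (m + B - t) = 0 := by rw [bS, h3]; rfl
          rw [h3, h4] at h2
          simpa using h2
        · exact bS_small N t _ (by omega)
      omega

lemma sum_getD (l : List ℕ) (n : ℕ) (h : l.length ≤ n) :
    ∑ i ∈ Finset.range n, l.getD i 0 = l.sum := by
  induction l generalizing n with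
  | nil => simp
  | cons a l ih =>
    obtain ⟨n, rfl⟩ : ∃ k, n = k + 1 := ⟨n - 1, by simp at h; omega⟩
    rw [Finset.sum_range_succ']
    simp only [List.getD_cons_succ, List.getD_cons_zero, List.sum_cons]
    rw [ih n (by simpa using h)]; ring

/-- Sorted parts. -/
def sl {n : ℕ} (lam : Nat.Partition n) : List ℕ := (lam.parts.sort (· ≤ ·)).reverse

lemma sl_coe {n : ℕ} (lam : Nat.Partition n) : (sl lam : Multiset ℕ) = lam.parts := by
  rw [sl, Multiset.coe_reverse, Multiset.sort_eq]

lemma sl_pos {n : ℕ} (lam : Nat.Partition n) (x : ℕ) (hx : x ∈ sl lam) : 0 < x := by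
  apply lam.parts_pos
  rw [← sl_coe lam]; exact hx

lemma sl_length {n : ℕ} (lam : Nat.Partition n) : (sl lam).length ≤ n := by
  have h1 : (sl lam).length = lam.parts.card := by rw [← sl_coe lam]; rfl
  have h2 := Multiset.card_nsmul_le_sum (s := lam.parts) (a := 1) (fun x hx => lam.parts_pos hx)
  rw [lam.parts_sum, smul_eq_mul, mul_one] at h2
  omega

lemma sl_antitone {n : ℕ} (lam : Nat.Partition n) (i j : ℕ) (hij : i < j) :
    (sl lam).getD j 0 ≤ (sl lam).getD i 0 := by
  by_cases hj : j < (sl lam).length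
  · have hp : (sl lam).Pairwise (fun a b => b ≤ a) := by
      rw [sl, List.pairwise_reverse]
      exact Multiset.pairwise_sort _ _
    rw [List.getD_eq_getElem _ _ hj, List.getD_eq_getElem _ _ (hij.trans hj)]
    exact List.pairwise_iff_getElem.1 hp i j _ _ hij
  · rw [List.getD_eq_default _ _ (by omega)]
    exact Nat.zero_le _

lemma bt_anti {n : ℕ} (lam : Nat.Partition n) : StrictAnti (bt lam) := by
  intro i j hij
  have h1 := sl_antitone lam i j hij
  have h2 : (i : ℕ) < j := hij
  have h3 := j.2
  change (sl lam).getD j 0 + (n - 1 - j) < (sl lam).getD i 0 + (n - 1 - i)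
  omega

/-- Beta set. -/
def bX {n : ℕ} (lam : Nat.Partition n) : Finset ℕ := Finset.univ.image (bt lam)

lemma bX_mem {n : ℕ} (lam : Nat.Partition n) : bX lam ∈ bV n (n + ∑ i ∈ Finset.range n, i) := by
  rw [mem_bV]
  constructor
  · rw [bX, Finset.card_image_of_injective _ (bt_anti lam).injective, Finset.card_univ,
      Fintype.card_fin]
  · rw [bX, Finset.sum_image fun a _ b _ h => (bt_anti lam).injective h]
    have h1 : ∑ i : Fin n, bt lam i =
        ∑ i : Fin n, (sl lam).getD i 0 + ∑ i : Fin n, (n - 1 - (i : ℕ)) := by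
      rw [← Finset.sum_add_distrib]; rfl
    rw [h1, Fin.sum_univ_eq_sum_range (fun i => (sl lam).getD i 0),
      Fin.sum_univ_eq_sum_range (fun i => n - 1 - i), sum_getD _ _ (sl_length lam),
      Finset.sum_range_reflect (fun i => i) n]
    congr 1
    have := lam.parts_sum
    rw [← sl_coe lam, Multiset.sum_coe] at this
    exact this

lemma list_eq_of_getD (l l' : List ℕ) (hl : ∀ x ∈ l, 0 < x) (hl' : ∀ x ∈ l', 0 < x)
    (h : ∀ i, l.getD i 0 = l'.getD i 0) : l = l' := by
  have key : ∀ a b : List ℕ, (∀ x ∈ a, 0 < x) → (∀ i, a.getD i 0 = b.getD i 0) →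
      a.length ≤ b.length := by
    intro a b ha hh
    by_contra hlt
    push Not at hlt
    have h1 := hh b.length
    rw [List.getD_eq_getElem _ _ hlt, List.getD_eq_default _ _ le_rfl] at h1
    have := ha _ (List.getElem_mem hlt)
    omega
  have hlen : l.length = l'.length :=
    le_antisymm (key l l' hl h) (key l' l hl' fun i => (h i).symm)
  refine List.ext_getElem hlen fun i h1 h2 => ?_
  have := h i
  rwa [List.getD_eq_getElem _ _ h1, List.getD_eq_getElem _ _ h2] at this

lemma bX_inj {n : ℕ} : Function.Injective (bX : Nat.Partition n → Finset ℕ) := by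
  intro lam lam' h
  have hc : ∀ ν : Nat.Partition n, (bX ν).card = n := fun ν => (mem_bV.1 (bX_mem ν)).1
  have hu : ∀ ν : Nat.Partition n, (fun i => bt ν (Fin.rev i)) = (bX ν).orderEmbOfFin (hc ν) := by
    intro ν
    apply Finset.orderEmbOfFin_unique
    · intro i; exact Finset.mem_image_of_mem _ (Finset.mem_univ _)
    · intro i j hij; exact bt_anti ν (Fin.rev_lt_rev.2 hij)
  have h1 : bt lam = bt lam' := by
    have h2 : (fun i => bt lam (Fin.rev i)) = fun i => bt lam' (Fin.rev i) := by
      rw [hu lam, hu lam']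
      congr 2
    ext i
    have := congrFun h2 (Fin.rev i)
    simpa using this
  have h3 : sl lam = sl lam' := by
    refine list_eq_of_getD _ _ (sl_pos lam) (sl_pos lam') fun i => ?_
    by_cases hi : i < n
    · have := congrFun h1 ⟨i, hi⟩
      change (sl lam).getD i 0 + (n - 1 - i) = (sl lam').getD i 0 + (n - 1 - i) at this
      omega
    · have := sl_length lam
      have := sl_length lam'
      rw [List.getD_eq_default _ _ (by omega), List.getD_eq_default _ _ (by omega)]
  apply Nat.Partition.ext
  rw [← sl_coe lam, ← sl_coe lam', h3]

lemma bad_lam_le (n t : ℕ) (ht : 0 < t) :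
    (Finset.univ.filter fun lam : Nat.Partition n =>
      ∃ i : Fin n, t ≤ bt lam i ∧ ∀ i', bt lam i' ≠ bt lam i - t).card ≤
    t * ∑ k ∈ Finset.Icc 1 (n / t), pt (n - k * t) := by
  refine le_trans ?_ (bS_le n t ht n)
  rw [bS]
  calc _ = ∑ X ∈ ((Finset.univ.filter fun lam : Nat.Partition n =>
      ∃ i : Fin n, t ≤ bt lam i ∧ ∀ i', bt lam i' ≠ bt lam i - t).image bX), 1 := by
        rw [Finset.sum_const, smul_eq_mul, mul_one, Finset.card_image_of_injective _ bX_inj]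
    _ ≤ ∑ X ∈ ((Finset.univ.filter fun lam : Nat.Partition n =>
      ∃ i : Fin n, t ≤ bt lam i ∧ ∀ i', bt lam i' ≠ bt lam i - t).image bX), (remB t X).card := by
        refine Finset.sum_le_sum fun X hX => ?_
        obtain ⟨lam, hl, rfl⟩ := Finset.mem_image.1 hX
        obtain ⟨i, h1, h2⟩ := (Finset.mem_filter.1 hl).2
        refine Finset.card_pos.2 ⟨bt lam i, ?_⟩
        rw [remB, Finset.mem_filter]
        refine ⟨Finset.mem_image_of_mem _ (Finset.mem_univ _), h1, ?_⟩
        intro hh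
        obtain ⟨i', _, h3⟩ := Finset.mem_image.1 hh
        exact h2 i' h3
    _ ≤ _ := by
        refine Finset.sum_le_sum_of_subset ?_
        intro X hX
        obtain ⟨lam, _, rfl⟩ := Finset.mem_image.1 hX
        exact bX_mem lam

lemma choose_t (x : ℝ) (hx : 4 ≤ x) : ∃ m j : ℕ, 0 < m ∧ m ≤ 5 ∧
    x ≤ ((2 ^ j * m : ℕ) : ℝ) ∧ ((2 ^ j * m : ℕ) : ℝ) ≤ 4 / 3 * x := by
  obtain ⟨i, h1, h2⟩ := exists_nat_pow_near (x := x) (y := 2) (by linarith) (by norm_num)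
  have hi : 2 ≤ i := by
    by_contra hlt
    have h3 : i + 1 ≤ 2 := by omega
    have h4 : (2 : ℝ) ^ (i + 1) ≤ 2 ^ 2 := pow_le_pow_right₀ (by norm_num) h3
    norm_num at h4
    linarith
  obtain ⟨a, rfl⟩ : ∃ a, i = a + 2 := ⟨i - 2, by omega⟩
  have e1 : (2 : ℝ) ^ (a + 2) = 4 * 2 ^ a := by ring
  have e2 : (2 : ℝ) ^ (a + 2 + 1) = 8 * 2 ^ a := by ring
  rw [e1] at h1
  rw [e2] at h2
  by_cases h5 : x ≤ 5 * 2 ^ a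
  · refine ⟨5, a, by norm_num, by norm_num, ?_, ?_⟩ <;> push_cast <;> linarith
  · by_cases h6 : x ≤ 6 * 2 ^ a
    · refine ⟨3, a + 1, by norm_num, by norm_num, ?_, ?_⟩ <;> push_cast <;> rw [pow_succ] <;> linarith
    · refine ⟨1, a + 3, by norm_num, by norm_num, ?_, ?_⟩ <;> push_cast <;> rw [pow_add] <;> linarith

lemma bad_lam_bound {c η : ℝ} {n t : ℕ} (h : UB c η n) (hη : 0 < η) (ht : 0 < t)
    (hq : Real.exp (-((c - η) * t / Real.sqrt n)) ≤ 1 / 2) :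
    ((Finset.univ.filter fun lam : Nat.Partition n =>
      ∃ i : Fin n, t ≤ bt lam i ∧ ∀ i', bt lam i' ≠ bt lam i - t).card : ℝ) ≤
    2 * (1 + η) * (t * Real.exp (-((c - η) * t / Real.sqrt n))) * pt n := by
  set q := Real.exp (-((c - η) * t / Real.sqrt n)) with hqd
  have hq0 : 0 < q := Real.exp_pos _
  have h1 : ((Finset.univ.filter fun lam : Nat.Partition n =>
      ∃ i : Fin n, t ≤ bt lam i ∧ ∀ i', bt lam i' ≠ bt lam i - t).card : ℝ) ≤
      t * ∑ k ∈ Finset.Icc 1 (n / t), (pt (n - k * t) : ℝ) := by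
    exact_mod_cast bad_lam_le n t ht
  have h2 : ∀ k ∈ Finset.Icc 1 (n / t), (pt (n - k * t) : ℝ) ≤ (1 + η) * pt n * q ^ k := by
    intro k hk
    have hk' : k * t ≤ n := by
      have := (Finset.mem_Icc.1 hk).2
      exact (Nat.le_div_iff_mul_le ht).1 this
    refine (h (k * t) hk').trans (le_of_eq ?_)
    have : Real.exp (-((c - η) * (k * t : ℕ) / Real.sqrt n)) = q ^ k := by
      rw [hqd, ← Real.exp_nat_mul]; congr 1; push_cast; ring
    rw [this]; ring
  have h3 : ∀ N : ℕ, (1 - q) * ∑ j ∈ Finset.Icc 1 N, q ^ j = q - q ^ (N + 1) := by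
    intro N
    induction N with
    | zero => simp
    | succ k ih => rw [Finset.sum_Icc_succ_top (by omega), mul_add, ih]; ring
  have h4 : ∑ j ∈ Finset.Icc 1 (n / t), q ^ j ≤ 2 * q := by
    have h5 := h3 (n / t)
    have h6 : 0 < q ^ (n / t + 1) := by positivity
    have h7 : 0 ≤ ∑ j ∈ Finset.Icc 1 (n / t), q ^ j := Finset.sum_nonneg fun _ _ => by positivity
    nlinarith
  have hp : (0 : ℝ) < pt n := Nat.cast_pos.2 (pt_pos n)
  calc _ ≤ _ := h1
    _ ≤ t * ∑ k ∈ Finset.Icc 1 (n / t), (1 + η) * pt n * q ^ k := by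
        gcongr with k hk; exact h2 k hk
    _ = t * ((1 + η) * pt n * ∑ k ∈ Finset.Icc 1 (n / t), q ^ k) := by rw [← Finset.mul_sum]
    _ ≤ t * ((1 + η) * pt n * (2 * q)) := by gcongr
    _ = _ := by ring

lemma odd_count (n m K j : ℕ) (hm : 0 < m) (B : ℝ) (hB : ((2 ^ j * m : ℕ) : ℝ) ≤ B) :
    (Nat.card {q : Nat.Partition n × Nat.Partition n // Odd (charSn n q.1 q.2)} : ℝ) ≤
      (((Finset.univ.filter fun lam : Nat.Partition n =>
      ∃ i : Fin n, 2 ^ j * m ≤ bt lam i ∧ ∀ i', bt lam i' ≠ bt lam i - 2 ^ j * m).card : ℝ) +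
      ((Finset.univ.filter (fun μ : Nat.Partition n =>
        (∑ d ∈ ((Finset.range K).image (fun k => 2 ^ k * m) : Finset ℕ), (d : ℝ) * μ.parts.count d) ≤ B)).card : ℝ))
      * pt n := by
  classical
  set bl := Finset.univ.filter fun lam : Nat.Partition n =>
      ∃ i : Fin n, 2 ^ j * m ≤ bt lam i ∧ ∀ i', bt lam i' ≠ bt lam i - 2 ^ j * m with hbl
  set bm := Finset.univ.filter (fun μ : Nat.Partition n =>
        (∑ d ∈ ((Finset.range K).image (fun k => 2 ^ k * m) : Finset ℕ), (d : ℝ) * μ.parts.count d) ≤ B) with hbm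
  have hsub : Finset.univ.filter (fun q : Nat.Partition n × Nat.Partition n =>
      Odd (charSn n q.1 q.2)) ⊆ (bl ×ˢ Finset.univ) ∪ (Finset.univ ×ˢ bm) := by
    rintro ⟨lam, mu⟩ hq
    have hodd : Odd (charSn n lam mu) := (Finset.mem_filter.1 hq).2
    rw [Finset.mem_union, Finset.mem_product, Finset.mem_product]
    by_cases hmu : mu ∈ bm
    · exact Or.inr ⟨Finset.mem_univ _, hmu⟩
    · refine Or.inl ⟨?_, Finset.mem_univ _⟩
      rw [hbm, Finset.mem_filter, not_and] at hmu
      have h1 := not_le.1 (hmu (Finset.mem_univ _))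
      rw [Finset.sum_image (fun a _ b _ h =>
        Nat.pow_right_injective le_rfl (Nat.eq_of_mul_eq_mul_right hm h))] at h1
      have h2 : ∑ k ∈ Finset.range K, ((2 ^ k * m : ℕ) : ℝ) * mu.parts.count (2 ^ k * m) =
          ((m * ∑ k ∈ Finset.range K, 2 ^ k * mu.parts.count (2 ^ k * m) : ℕ) : ℝ) := by
        rw [Finset.mul_sum]
        push_cast
        refine Finset.sum_congr rfl fun k _ => ?_
        ring
      rw [h2] at h1
      have h3 : 2 ^ j * m < m * ∑ k ∈ Finset.range K, 2 ^ k * mu.parts.count (2 ^ k * m) := by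
        exact_mod_cast lt_of_le_of_lt hB h1
      rw [mul_comm] at h3
      have h4 := Nat.lt_of_mul_lt_mul_left h3
      rw [hbl, Finset.mem_filter]
      exact ⟨Finset.mem_univ _, odd_imp m K j hm lam mu h4.le hodd⟩
  have hcard : Nat.card {q : Nat.Partition n × Nat.Partition n // Odd (charSn n q.1 q.2)} ≤
      bl.card * pt n + pt n * bm.card := by
    rw [Nat.card_eq_fintype_card, Fintype.card_subtype]
    refine (Finset.card_le_card hsub).trans ((Finset.card_union_le _ _).trans ?_)
    rw [Finset.card_product, Finset.card_product, Finset.card_univ, pt]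
  calc _ ≤ ((bl.card * pt n + pt n * bm.card : ℕ) : ℝ) := by exact_mod_cast hcard
    _ = _ := by push_cast; ring

lemma main_bound (ε : ℝ) (hε : 0 < ε) : ∀ᶠ n : ℕ in atTop,
    (Nat.card {q : Nat.Partition n × Nat.Partition n // Odd (charSn n q.1 q.2)} : ℝ) ≤
      ε * (pt n : ℝ) ^ 2 := by
  obtain ⟨c, hc, hU, hL⟩ := pt_asymp
  obtain ⟨δ, hδ, K0, hconc⟩ := conc c hc hU hL (ε / 2) (1 / 100) (by positivity) (by norm_num)
  set η := c / 50 with hη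
  have hη0 : 0 < η := by positivity
  have hηc : η < c := by rw [hη]; linarith
  have hlog : Tendsto (fun n : ℕ => Real.log (n : ℝ)) atTop atTop :=
    Real.tendsto_log_atTop.comp tendsto_natCast_atTop_atTop
  have ev1 := hlog.eventually_ge_atTop (342 : ℝ)
  have ev2 := hlog.eventually_ge_atTop (8 * c : ℝ)
  have ev3 := hlog.eventually_ge_atTop ((K0 + 1) / 0.71 : ℝ)
  have hexp : Tendsto (fun n : ℕ => Real.exp (0.0078 * Real.log (n : ℝ))) atTop atTop :=
    Real.tendsto_exp_atTop.comp (hlog.const_mul_atTop (by norm_num))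
  have ev4 := hexp.eventually_ge_atTop (5 / δ)
  have hdec : Tendsto (fun x : ℝ => 2 * (1 + η) * (0.7 / c) * (x * Real.exp (-(0.01 * x))))
      atTop (nhds 0) := by
    have := (Real.tendsto_pow_mul_exp_neg_atTop_nhds_zero 1).comp
      (tendsto_id.const_mul_atTop (show (0 : ℝ) < 0.01 by norm_num))
    have h2 := this.const_mul (2 * (1 + η) * (0.7 / c) * 100)
    rw [mul_zero] at h2
    refine h2.congr fun x => ?_
    simp only [Function.comp, id, pow_one]
    ring
  have ev5 := (hdec.comp hlog).eventually_le_const (show (0 : ℝ) < ε / 2 by positivity)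
  filter_upwards [hconc, hU η hη0 hηc, ev1, ev2, ev3, ev4, ev5, eventually_gt_atTop 0] with
    n hcn hub h1 h2 h3 h4 h5 hn
  have hnr : (0 : ℝ) < n := by exact_mod_cast hn
  have hsn := Real.sqrt_pos.2 hnr
  have hp : (0 : ℝ) < pt n := Nat.cast_pos.2 (pt_pos n)
  set L := Real.log (n : ℝ) with hLd
  have hs : Real.sqrt n = Real.exp (L / 2) := by
    rw [Real.sqrt_eq_iff_mul_self_eq hnr.le (Real.exp_pos _).le, ← Real.exp_add, add_halves, hLd,
      Real.exp_log hnr]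
  set s := Real.sqrt (n : ℝ) with hsd
  have hs1 : 1 ≤ s := by rw [hs]; exact Real.one_le_exp (by linarith)
  set T := s * L / (2 * c) with hT
  have hT4 : 4 ≤ 1.05 * T := by
    have : 4 ≤ T := by
      rw [hT, le_div_iff₀ (by positivity)]
      nlinarith
    linarith
  obtain ⟨m, j, hm, hm5, ht1, ht2⟩ := choose_t (1.05 * T) hT4
  set t := 2 ^ j * m with ht
  have ht0 : 0 < t := by positivity
  have ht3 : (t : ℝ) ≤ 1.4 * T := by linarith
  set K := ⌊0.71 * L⌋₊ with hK
  have hK1 : (K : ℝ) ≤ 0.71 * L := Nat.floor_le (by linarith)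
  have hK2 : 0.71 * L < K + 1 := Nat.lt_floor_add_one _
  set Ds := (Finset.range K).image (fun k => 2 ^ k * m) with hDs
  have hDc : Ds.card = K := by
    rw [hDs, Finset.card_image_of_injective _ (fun a b h =>
        Nat.pow_right_injective le_rfl (Nat.eq_of_mul_eq_mul_right hm h)), Finset.card_range]
  have hK0 : K0 ≤ Ds.card := by
    rw [hDc]
    have h6 : (K0 + 1 : ℝ) ≤ 0.71 * L := by
      rw [div_le_iff₀ (by norm_num)] at h3; linarith
    have : (K0 : ℝ) < K := by linarith
    exact_mod_cast this.le
  have hDd : ∀ d ∈ Ds, 0 < d ∧ (d : ℝ) ≤ δ * s := by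
    intro d hd
    obtain ⟨k, hk, rfl⟩ := Finset.mem_image.1 hd
    refine ⟨by positivity, ?_⟩
    have hkK : (k : ℝ) ≤ K := by exact_mod_cast (Finset.mem_range.1 hk).le
    have hm5' : (m : ℝ) ≤ 5 := by exact_mod_cast hm5
    have e1 : (2 : ℝ) ^ k ≤ Real.exp (0.4922 * L) := by
      have e2 : (2 : ℝ) ^ k = Real.exp (k * Real.log 2) := by
        rw [Real.exp_nat_mul, Real.exp_log (by norm_num)]
      rw [e2, Real.exp_le_exp]
      have hl2 := Real.log_two_lt_d9
      have hl3 : 0 < Real.log 2 := Real.log_pos (by norm_num)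
      have : (k : ℝ) * Real.log 2 ≤ (0.71 * L) * 0.6931471808 := by
        apply mul_le_mul (by linarith) hl2.le hl3.le (by linarith)
      linarith
    have e3 : 5 * Real.exp (0.4922 * L) ≤ δ * s := by
      rw [hs, show L / 2 = 0.0078 * L + 0.4922 * L by ring, Real.exp_add]
      rw [div_le_iff₀ hδ] at h4
      have := mul_le_mul_of_nonneg_right h4 (Real.exp_pos (0.4922 * L)).le
      linarith
    push_cast
    have e4 : (2 : ℝ) ^ k * m ≤ Real.exp (0.4922 * L) * 5 := by gcongr
    linarith
  have hbm := hcn Ds hDd hK0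
  rw [hDc] at hbm
  have hB : (t : ℝ) ≤ (1 - 1 / 100) * (K * s / c) := by
    have e1 : 1.4 * T = 0.7 * L * (s / c) := by rw [hT]; field_simp; norm_num
    have e2 : (1 - 1 / 100) * (K * s / c) = (0.99 * K) * (s / c) := by ring
    rw [e2]
    refine ht3.trans ?_
    rw [e1]
    have e3 : 0.7 * L ≤ 0.99 * (K : ℝ) := by linarith
    gcongr
  have hfin := odd_count n m K j hm _ hB
  have hqe : Real.exp (-((c - η) * t / s)) ≤ Real.exp (-(0.51 * L)) := by
    rw [Real.exp_le_exp, neg_le_neg_iff, le_div_iff₀ hsn]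
    have e1 : c - η = 0.98 * c := by rw [hη]; ring
    have e2 : (0.98 * c) * (1.05 * T) = 0.5145 * L * s := by rw [hT]; field_simp; norm_num
    have e3 : (0.98 * c) * (1.05 * T) ≤ (0.98 * c) * t := by gcongr
    have e4 : 0 ≤ L * s := by
      apply mul_nonneg <;> linarith
    rw [e1]
    linarith
  have hq2 : Real.exp (-(0.51 * L)) ≤ 1 / 2 := by
    have e1 := Real.add_one_le_exp (0.51 * L)
    rw [Real.exp_neg, one_div]
    apply inv_anti₀ (by norm_num)
    linarith
  have hbl := bad_lam_bound hub hη0 ht0 (hqe.trans hq2)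
  have hbl2 : 2 * (1 + η) * (t * Real.exp (-((c - η) * t / s))) ≤ ε / 2 := by
    refine le_trans ?_ h5
    simp only [Function.comp]
    have e1 : (t : ℝ) * Real.exp (-((c - η) * t / s)) ≤ 1.4 * T * Real.exp (-(0.51 * L)) := by
      gcongr
    have e2 : 1.4 * T * Real.exp (-(0.51 * L)) = 0.7 / c * (L * Real.exp (-(0.01 * L))) := by
      have e3 : s * Real.exp (-(0.51 * L)) = Real.exp (-(0.01 * L)) := by
        rw [hs, ← Real.exp_add]; congr 1; ring
      rw [← e3, hT]; field_simp; norm_num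
    rw [e2] at e1
    calc _ ≤ 2 * (1 + η) * (0.7 / c * (L * Real.exp (-(0.01 * L)))) := by gcongr
      _ = _ := by ring
  have hbl3 := hbl.trans (mul_le_mul_of_nonneg_right hbl2 hp.le)
  calc _ ≤ _ := hfin
    _ ≤ (ε / 2 * pt n + ε / 2 * pt n) * pt n :=
        mul_le_mul_of_nonneg_right (add_le_add hbl3 hbm) hp.le
    _ = _ := by ring

/-- The proportion of odd entries in the character table of `S_n` tends to `0`. -/
theorem density_odd_entries_tendsto_zero :
    Tendsto
      (fun n : ℕ =>
        (Nat.card {q : Nat.Partition n × Nat.Partition n // Odd (charSn n q.1 q.2)} : ℝ) /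
          (Nat.card (Nat.Partition n) : ℝ) ^ 2)
      atTop (nhds 0) := by
  rw [Metric.tendsto_nhds]
  intro ε hε
  filter_upwards [main_bound (ε / 2) (by positivity)] with n hn
  have hp : (0 : ℝ) < pt n := Nat.cast_pos.2 (pt_pos n)
  have hpc : (Nat.card (Nat.Partition n) : ℝ) = pt n := by rw [Nat.card_eq_fintype_card, pt]
  rw [hpc, Real.dist_eq, sub_zero, abs_of_nonneg (by positivity)]
  have : (Nat.card {q : Nat.Partition n × Nat.Partition n // Odd (charSn n q.1 q.2)} : ℝ) /
      (pt n : ℝ) ^ 2 ≤ ε / 2 := by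
    rw [div_le_iff₀ (by positivity)]; exact hn
  linarith
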